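/- Let x ≈ 1.17965 be the unique real root of the polynomial 1 + 4x² − 4x³. Every simple polygon P that admits a triangulation T_P in which k diagonals are flippable and l ≤ k of these flippable diagonals form a ps-flippable set has at least 2^l · x^{k−l} triangulations. -/

import Mathlib

open scoped Classical

noncomputable section

abbrev Pt : Type := ℝ × ℝ

/-- The closed straight segment spanned by an unordered pair of points. -/
def seg2 (e : Sym2 Pt) : Set Pt :=
  Sym2.lift ⟨fun p q => segment ℝ p q, fun p q => segment_symm ℝ p q⟩ e

/-- A finite set of points is in (strictly) convex position. -/
def InConvexPosition (Q : Finset Pt) : Prop :=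
  ∀ p ∈ Q, p ∉ convexHull ℝ (↑(Q.erase p) : Set Pt)

/-- `p q` is an edge of the convex hull boundary of `Q`. -/
def IsHullEdgeOf (Q : Finset Pt) (p q : Pt) : Prop :=
  p ∈ Q ∧ q ∈ Q ∧ p ≠ q ∧
    segment ℝ p q ⊆ frontier (convexHull ℝ (Q : Set Pt))

/-- `e` is a diagonal of the convex polygon with vertex set `Q`. -/
def IsDiagonalOf (Q : Finset Pt) (e : Sym2 Pt) : Prop :=
  ∃ p ∈ Q, ∃ q ∈ Q, e = s(p, q) ∧
    openSegment ℝ p q ⊆ interior (convexHull ℝ (Q : Set Pt))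

/-- A simple polygon in the plane (with vertices in general position),
given by the cyclic sequence of its vertices; consecutive boundary edges meet
only at shared endpoints, so the boundary is a simple closed polygonal curve. -/
structure SimplePolygon where
  n : ℕ
  three_le : 3 ≤ n
  vtx : Fin n → Pt
  inj : Function.Injective vtx
  genpos : ∀ i j k : Fin n, i ≠ j → i ≠ k → j ≠ k →
    ¬ Collinear ℝ ({vtx i, vtx j, vtx k} : Set Pt)
  noncrossing : ∀ i j : Fin n,
    s(vtx i, vtx (finRotate n i)) ≠ s(vtx j, vtx (finRotate n j)) →
    ∀ x ∈ segment ℝ (vtx i) (vtx (finRotate n i)) ∩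
          segment ℝ (vtx j) (vtx (finRotate n j)),
      x ∈ s(vtx i, vtx (finRotate n i)) ∧ x ∈ s(vtx j, vtx (finRotate n j))

/-- The boundary of the polygon. -/
def SimplePolygon.boundary (P : SimplePolygon) : Set Pt :=
  ⋃ i : Fin P.n, segment ℝ (P.vtx i) (P.vtx (finRotate P.n i))

/-- The open region inside the polygon: the union of the bounded connected
components of the complement of the boundary. -/
def SimplePolygon.inside (P : SimplePolygon) : Set Pt :=
  {x | x ∉ P.boundary ∧ Bornology.IsBounded (connectedComponentIn P.boundaryᶜ x)}

def SimplePolygon.IsVtx (P : SimplePolygon) (p : Pt) : Prop :=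
  ∃ i, p = P.vtx i

def SimplePolygon.IsBoundaryEdge (P : SimplePolygon) (e : Sym2 Pt) : Prop :=
  ∃ i, e = s(P.vtx i, P.vtx (finRotate P.n i))

/-- A diagonal of `P`: a segment between two vertices lying inside `P`. -/
def SimplePolygon.IsDiagonal (P : SimplePolygon) (e : Sym2 Pt) : Prop :=
  ∃ i j : Fin P.n, e = s(P.vtx i, P.vtx j) ∧
    openSegment ℝ (P.vtx i) (P.vtx j) ⊆ P.inside

/-- A triangulation of a simple polygon: a maximal set of pairwise
non-crossing diagonals. -/
structure PolyTriangulation (P : SimplePolygon) where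
  diags : Finset (Sym2 Pt)
  isDiag : ∀ e ∈ diags, P.IsDiagonal e
  noncrossing : ∀ e₁ ∈ diags, ∀ e₂ ∈ diags, e₁ ≠ e₂ →
    ∀ x ∈ seg2 e₁ ∩ seg2 e₂, x ∈ e₁ ∧ x ∈ e₂
  maximal : ∀ e, P.IsDiagonal e →
    (∀ e' ∈ diags, e ≠ e' → ∀ x ∈ seg2 e ∩ seg2 e', x ∈ e ∧ x ∈ e') → e ∈ diags

/-- The number of triangulations of the polygon `P`. -/
def polyTriCount (P : SimplePolygon) : ℕ := Nat.card (PolyTriangulation P)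

def PolyTriangulation.IsEdgeOrDiag {P : SimplePolygon} (D : PolyTriangulation P)
    (e : Sym2 Pt) : Prop :=
  P.IsBoundaryEdge e ∨ e ∈ D.diags

/-- `a b c` span a triangular face of the triangulated polygon. -/
def PolyTriangulation.IsFace {P : SimplePolygon} (D : PolyTriangulation P)
    (a b c : Pt) : Prop :=
  P.IsVtx a ∧ P.IsVtx b ∧ P.IsVtx c ∧
  D.IsEdgeOrDiag s(a, b) ∧ D.IsEdgeOrDiag s(b, c) ∧ D.IsEdgeOrDiag s(a, c) ∧
  ∀ i, P.vtx i ∉ interior (convexHull ℝ ({a, b, c} : Set Pt))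

/-- A diagonal is flippable if its two incident triangles form a convex
quadrilateral (equivalently, the two diagonals of that quadrilateral cross). -/
def PolyTriangulation.IsFlippable {P : SimplePolygon} (D : PolyTriangulation P)
    (e : Sym2 Pt) : Prop :=
  e ∈ D.diags ∧ ∃ a b c d : Pt, e = s(a, b) ∧ c ≠ d ∧
    D.IsFace a b c ∧ D.IsFace a b d ∧
    (openSegment ℝ a b ∩ openSegment ℝ c d).Nonempty

/-- The number of flippable diagonals of a triangulated polygon. -/
def PolyTriangulation.flipCount {P : SimplePolygon} (D : PolyTriangulation P) : ℕ :=
  (D.diags.filter (fun e => D.IsFlippable e)).card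

/-- `F` is a ps-flippable set of diagonals of the triangulated polygon: its
members are diagonals of pairwise interior-disjoint (empty) convex sub-polygons
whose boundary edges belong to the triangulation. -/
def PolyTriangulation.IsPsFlippableSet {P : SimplePolygon} (D : PolyTriangulation P)
    (F : Finset (Sym2 Pt)) : Prop :=
  F ⊆ D.diags ∧
  ∃ 𝒬 : Finset (Finset Pt),
    (∀ Q ∈ 𝒬, (∀ p ∈ Q, P.IsVtx p) ∧ 3 ≤ Q.card ∧ InConvexPosition Q ∧
      (∀ p q, IsHullEdgeOf Q p q → D.IsEdgeOrDiag s(p, q)) ∧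
      (∀ i, P.vtx i ∉ interior (convexHull ℝ (Q : Set Pt)))) ∧
    (∀ Q ∈ 𝒬, ∀ Q' ∈ 𝒬, Q ≠ Q' →
      interior (convexHull ℝ (Q : Set Pt)) ∩ interior (convexHull ℝ (Q' : Set Pt)) = ∅) ∧
    (∀ e ∈ F, ∃ Q ∈ 𝒬, IsDiagonalOf Q e)

/-- `P` is a convex polygon: its vertices are in convex position. -/
def SimplePolygon.IsConvex (P : SimplePolygon) : Prop :=
  InConvexPosition (Finset.image P.vtx Finset.univ)

/-! ### Orientation and elementary planar geometry -/

def crs (a b c : Pt) : ℝ := (b.1 - a.1) * (c.2 - a.2) - (b.2 - a.2) * (c.1 - a.1)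

def Compat (e f : Sym2 Pt) : Prop :=
  e = f ∨ ∀ x ∈ seg2 e ∩ seg2 f, x ∈ e ∧ x ∈ f

lemma seg2_mk (p q : Pt) : seg2 s(p, q) = segment ℝ p q := rfl

lemma Compat.symm {e f : Sym2 Pt} (h : Compat e f) : Compat f e := by
  rcases h with h | h
  · exact Or.inl h.symm
  · exact Or.inr fun x hx => (h x hx.symm).symm

lemma crs_affine (u w p q : Pt) (α β : ℝ) (h : α + β = 1) :
    crs u w (α • p + β • q) = α * crs u w p + β * crs u w q := by
  have : β = 1 - α := by linarith
  subst this
  simp only [crs, Prod.fst_add, Prod.snd_add, Prod.smul_fst, Prod.smul_snd, smul_eq_mul]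
  ring

lemma crs_rot (a b c : Pt) : crs b c a = crs a b c := by unfold crs; ring
lemma crs_rot' (a b c : Pt) : crs c a b = crs a b c := by unfold crs; ring
lemma crs_swap (a b c : Pt) : crs b a c = - crs a b c := by unfold crs; ring
lemma crs_swap' (a b c : Pt) : crs a c b = - crs a b c := by unfold crs; ring
lemma crs_left (a b : Pt) : crs a b a = 0 := by unfold crs; ring
lemma crs_right (a b : Pt) : crs a b b = 0 := by unfold crs; ring
lemma crs_same (a b : Pt) : crs a a b = 0 := by unfold crs; ring

lemma collinear_of_crs (p q r : Pt) (h : crs p q r = 0) :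
    Collinear ℝ ({p, q, r} : Set Pt) := by
  by_cases hpq : p = q
  · subst hpq
    simp only [Set.insert_eq_of_mem, Set.mem_insert_iff, true_or]
    exact collinear_pair ℝ p r
  · rw [collinear_iff_of_mem (p₀ := p) (by simp)]
    refine ⟨q - p, ?_⟩
    have hne : (q.1 - p.1) ^ 2 + (q.2 - p.2) ^ 2 ≠ 0 := by
      intro h0
      apply hpq
      have h1 : q.1 - p.1 = 0 := by nlinarith [sq_nonneg (q.1 - p.1), sq_nonneg (q.2 - p.2)]
      have h2 : q.2 - p.2 = 0 := by nlinarith [sq_nonneg (q.1 - p.1), sq_nonneg (q.2 - p.2)]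
      ext <;> linarith
    intro y hy
    simp only [Set.mem_insert_iff, Set.mem_singleton_iff] at hy
    rcases hy with rfl | rfl | rfl
    · exact ⟨0, by simp⟩
    · exact ⟨1, by simp⟩
    · refine ⟨((q.1 - p.1) * (y.1 - p.1) + (q.2 - p.2) * (y.2 - p.2)) /
        ((q.1 - p.1) ^ 2 + (q.2 - p.2) ^ 2), ?_⟩
      unfold crs at h
      ext
      · simp only [vadd_eq_add, Prod.fst_add, Prod.smul_fst, Prod.fst_sub, smul_eq_mul]
        field_simp
        linear_combination (-(q.2 - p.2)) * h
      · simp only [vadd_eq_add, Prod.snd_add, Prod.smul_snd, Prod.snd_sub, smul_eq_mul]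
        field_simp
        linear_combination ((q.1 - p.1)) * h

lemma SimplePolygon.gp (P : SimplePolygon) {p q r : Pt} (hp : P.IsVtx p) (hq : P.IsVtx q)
    (hr : P.IsVtx r) (hpq : p ≠ q) (hpr : p ≠ r) (hqr : q ≠ r) : crs p q r ≠ 0 := by
  obtain ⟨i, rfl⟩ := hp
  obtain ⟨j, rfl⟩ := hq
  obtain ⟨k, rfl⟩ := hr
  intro h
  exact P.genpos i j k (fun h => hpq (by rw [h])) (fun h => hpr (by rw [h]))
    (fun h => hqr (by rw [h])) (collinear_of_crs _ _ _ h)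

lemma crs_of_mem_segment {u w y : Pt} (h : y ∈ segment ℝ u w) : crs u w y = 0 := by
  obtain ⟨α, β, _, _, hs, rfl⟩ := h
  rw [crs_affine _ _ _ _ _ _ hs, crs_left, crs_right]; ring

/-- A vertex on a segment between two vertices is an endpoint. -/
lemma SimplePolygon.vtx_on_seg (P : SimplePolygon) {p q y : Pt} (hp : P.IsVtx p) (hq : P.IsVtx q)
    (hy : P.IsVtx y) (h : y ∈ segment ℝ p q) : y = p ∨ y = q := by
  by_cases hpq : p = q
  · subst hpq; simp at h; exact Or.inl h
  by_contra hc
  push Not at hc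
  exact P.gp hp hq hy hpq (Ne.symm hc.1) (Ne.symm hc.2) (crs_of_mem_segment h)

/-- Two chords on the same closed side are compatible. -/
lemma compat_of_side {u w p q : Pt} (hp : 0 ≤ crs u w p) (hq : 0 ≤ crs u w q)
    (hp0 : crs u w p = 0 → p = u ∨ p = w) (hq0 : crs u w q = 0 → q = u ∨ q = w) :
    Compat s(u, w) s(p, q) := by
  by_cases heq : s(u, w) = s(p, q)
  · exact Or.inl heq
  right
  rintro x ⟨h1, h2⟩
  rw [seg2_mk] at h1 h2
  have hx := crs_of_mem_segment h1
  obtain ⟨α, β, hα, hβ, hs, rfl⟩ := h2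
  rw [crs_affine _ _ _ _ _ _ hs] at hx
  have e1 : α * crs u w p = 0 := by nlinarith [mul_nonneg hα hp, mul_nonneg hβ hq]
  have e2 : β * crs u w q = 0 := by nlinarith [mul_nonneg hα hp, mul_nonneg hβ hq]
  rcases mul_eq_zero.1 e1 with ha | ha
  · have hb : β = 1 := by linarith
    subst hb ha
    have := hq0 (by simpa using e2)
    simp only [zero_smul, one_smul, zero_add, Sym2.mem_iff]
    exact ⟨this, Or.inr trivial⟩
  · rcases mul_eq_zero.1 e2 with hb | hb
    · have ha1 : α = 1 := by linarith
      subst ha1 hb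
      have := hp0 ha
      simp only [zero_smul, one_smul, add_zero, Sym2.mem_iff]
      exact ⟨this, Or.inl trivial⟩
    · have hp1 := hp0 ha
      have hq1 := hq0 hb
      by_cases hpq : p = q
      · subst hpq
        rw [← add_smul, hs, one_smul]
        simp only [Sym2.mem_iff]
        exact ⟨hp1, Or.inl trivial⟩
      · exfalso
        apply heq
        rcases hp1 with rfl | rfl <;> rcases hq1 with rfl | rfl
        · exact absurd rfl hpq
        · rfl
        · exact Sym2.eq_swap
        · exact absurd rfl hpq

lemma not_compat_of_open {a b c d y : Pt} (hac : a ≠ c) (hab : a ≠ b) (had : a ≠ d)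
    (h1 : y ∈ openSegment ℝ a c) (h2 : y ∈ openSegment ℝ b d) : ¬ Compat s(a, c) s(b, d) := by
  rintro (h | h)
  · rw [Sym2.eq_iff] at h
    rcases h with h | h
    · exact hab h.1
    · exact had h.1
  · have := (h y ⟨openSegment_subset_segment _ _ _ h1, openSegment_subset_segment _ _ _ h2⟩).1
    rw [Sym2.mem_iff] at this
    rcases this with rfl | rfl
    · exact hac ((left_mem_openSegment_iff (𝕜 := ℝ)).1 h1)
    · exact hac ((right_mem_openSegment_iff (𝕜 := ℝ)).1 h1)

/-- Interleaved chords of a counterclockwise quadrilateral cross. -/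
lemma exists_cross {a b c d : Pt} (h1 : 0 < crs a b c) (h2 : 0 < crs a b d)
    (h3 : 0 < crs a c d) (h4 : 0 < crs b c d) :
    ∃ y, y ∈ openSegment ℝ a c ∧ y ∈ openSegment ℝ b d := by
  have hs : crs a b c + crs a c d = crs a b d + crs b c d := by unfold crs; ring
  have hpos : 0 < crs a b c + crs a c d := by linarith
  have hpos' : 0 < crs a b d + crs b c d := by linarith
  refine ⟨(crs b c d / (crs a b d + crs b c d)) • a + (crs a b d / (crs a b d + crs b c d)) • c,
    ⟨_, _, by positivity, by positivity, by field_simp; ring, rfl⟩,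
    ⟨crs a c d / (crs a b d + crs b c d), crs a b c / (crs a b d + crs b c d), by positivity,
      by positivity, ?_, ?_⟩⟩
  · field_simp; linarith
  · ext
    · simp only [Prod.fst_add, Prod.smul_fst, smul_eq_mul]
      field_simp
      unfold crs; ring
    · simp only [Prod.snd_add, Prod.smul_snd, smul_eq_mul]
      field_simp
      unfold crs; ring

lemma ne_of_crs {a b c : Pt} (h : 0 < crs a b c) : a ≠ b ∧ a ≠ c ∧ b ≠ c := by
  refine ⟨?_, ?_, ?_⟩ <;> rintro rfl <;> unfold crs at h <;> nlinarith

lemma not_compat_cross {a b c d : Pt} (h1 : 0 < crs a b c) (h2 : 0 < crs a b d)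
    (h3 : 0 < crs a c d) (h4 : 0 < crs b c d) : ¬ Compat s(a, c) s(b, d) := by
  obtain ⟨y, hy1, hy2⟩ := exists_cross h1 h2 h3 h4
  exact not_compat_of_open (ne_of_crs h1).2.1 (ne_of_crs h1).1 (ne_of_crs h2).2.1 hy1 hy2

/-- Non-compatible chords between polygon vertices cross in relative interiors. -/
lemma SimplePolygon.cross_of_not_compat (P : SimplePolygon) {p q r t : Pt} (hp : P.IsVtx p)
    (hq : P.IsVtx q) (hr : P.IsVtx r) (ht : P.IsVtx t) (h : ¬ Compat s(p, q) s(r, t)) :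
    ∃ y, y ∈ openSegment ℝ p q ∧ y ∈ openSegment ℝ r t := by
  unfold Compat at h
  push Not at h
  obtain ⟨hne, x, ⟨hx1, hx2⟩, hx⟩ := h
  rw [seg2_mk] at hx1 hx2
  have hnv : ¬ P.IsVtx x := by
    intro hv
    apply hx
    · rw [Sym2.mem_iff]; exact P.vtx_on_seg hp hq hv hx1
    · rw [Sym2.mem_iff]; exact P.vtx_on_seg hr ht hv hx2
  refine ⟨x, mem_openSegment_of_ne_left_right ?_ ?_ hx1, mem_openSegment_of_ne_left_right ?_ ?_ hx2⟩
    <;> rintro rfl <;> exact hnv ‹_›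

/-! ### Convex hulls -/

lemma crs_cont (u w : Pt) : Continuous (crs u w) := by unfold crs; fun_prop

lemma convex_crs_nonneg (u w : Pt) : Convex ℝ {y : Pt | 0 ≤ crs u w y} := by
  intro p hp q hq α β hα hβ hs
  simp only [Set.mem_ofPred_eq] at *
  rw [crs_affine _ _ _ _ _ _ hs]
  positivity

lemma interior_halfplane {K : Set Pt} {u w y : Pt} (huw : u ≠ w)
    (hK : ∀ q ∈ K, 0 ≤ crs u w q) (hy : y ∈ interior (convexHull ℝ K)) : 0 < crs u w y := by
  have hsub : convexHull ℝ K ⊆ {y : Pt | 0 ≤ crs u w y} :=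
    convexHull_min hK (convex_crs_nonneg u w)
  have h0 : 0 ≤ crs u w y := hsub (interior_subset hy)
  rcases h0.lt_or_eq with h | h
  · exact h
  exfalso
  let g : ℝ → Pt := fun t => (y.1 + t * (w.2 - u.2), y.2 - t * (w.1 - u.1))
  have hg : Continuous g := by fun_prop
  have hg0 : g 0 ∈ interior (convexHull ℝ K) := by simpa [g] using hy
  have hnb : ∀ᶠ t in nhds (0:ℝ), g t ∈ interior (convexHull ℝ K) :=
    hg.continuousAt.eventually (isOpen_interior.mem_nhds hg0)
  obtain ⟨ε, hε, hb⟩ := Metric.eventually_nhds_iff.1 hnb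
  have hin := hsub (interior_subset (hb (y := ε / 2) (by
    rw [Real.dist_eq, sub_zero, abs_of_pos (by positivity)]; linarith)))
  have hc : crs u w (g (ε / 2)) = crs u w y - ε / 2 * ((w.1 - u.1) ^ 2 + (w.2 - u.2) ^ 2) := by
    simp only [g, crs]; ring
  simp only [Set.mem_ofPred_eq, hc, ← h] at hin
  have hn : (w.1 - u.1) ^ 2 + (w.2 - u.2) ^ 2 ≤ 0 := by nlinarith
  apply huw
  have h1 : w.1 - u.1 = 0 := by nlinarith [sq_nonneg (w.1 - u.1), sq_nonneg (w.2 - u.2)]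
  have h2 : w.2 - u.2 = 0 := by nlinarith [sq_nonneg (w.1 - u.1), sq_nonneg (w.2 - u.2)]
  ext <;> linarith

/-- Supporting functional. -/
lemma exists_support {K : Set Pt} {w : Pt} (hK : Convex ℝ K) (hne : (interior K).Nonempty)
    (hw : w ∉ interior K) :
    ∃ f : Pt →L[ℝ] ℝ, f ≠ 0 ∧ (∀ a ∈ interior K, f a < f w) ∧ ∀ a ∈ K, f a ≤ f w := by
  obtain ⟨f, hf⟩ := geometric_hahn_banach_open_point hK.interior isOpen_interior hw
  refine ⟨f, ?_, hf, ?_⟩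
  · rintro rfl
    obtain ⟨z, hz⟩ := hne
    simpa using hf z hz
  · intro a ha
    have hcl : a ∈ closure (interior K) := by
      rw [hK.closure_interior_eq_closure_of_nonempty_interior hne]; exact subset_closure ha
    have : closure (interior K) ⊆ {a | f a ≤ f w} :=
      closure_minimal (fun z hz => (hf z hz).le) (isClosed_le f.continuous continuous_const)
    exact this hcl

lemma crs_zero_of_level {f : Pt →L[ℝ] ℝ} (hf : f ≠ 0) {p q r : Pt} (h1 : f q = f p)
    (h2 : f r = f p) : crs p q r = 0 := by
  have key : ∀ z : Pt, f z = z.1 * f (1, 0) + z.2 * f (0, 1) := by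
    intro z
    have : z = z.1 • ((1, 0) : Pt) + z.2 • ((0, 1) : Pt) := by ext <;> simp
    conv_lhs => rw [this, map_add, map_smul, map_smul]
    rfl
  rw [key q, key p] at h1
  rw [key r, key p] at h2
  by_contra hc
  apply hf
  have ha : f (1, 0) = 0 := by
    have : crs p q r * f (1, 0) = 0 := by
      unfold crs; linear_combination (r.2 - p.2) * h1 - (q.2 - p.2) * h2
    exact (mul_eq_zero.1 this).resolve_left hc
  have hb : f (0, 1) = 0 := by
    have : crs p q r * f (0, 1) = 0 := by
      unfold crs; linear_combination (q.1 - p.1) * h2 - (r.1 - p.1) * h1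
    exact (mul_eq_zero.1 this).resolve_left hc
  ext <;> simp [ha, hb]

lemma hull_closed (Q : Finset Pt) : IsClosed (convexHull ℝ (Q : Set Pt)) :=
  (Q.finite_toSet.isCompact_convexHull ℝ).isClosed

/-- Points of the frontier of a hull are vertices or lie on hull edges. -/
lemma frontier_hull (P : SimplePolygon) {Q : Finset Pt} (hQ : ∀ p ∈ Q, P.IsVtx p)
    (hne : (interior (convexHull ℝ (Q : Set Pt))).Nonempty) {w : Pt}
    (hw : w ∈ frontier (convexHull ℝ (Q : Set Pt))) :
    w ∈ Q ∨ ∃ p q, IsHullEdgeOf Q p q ∧ w ∈ segment ℝ p q := by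
  have hw1 : w ∈ convexHull ℝ (Q : Set Pt) := (hull_closed Q).frontier_subset hw
  have hw2 : w ∉ interior (convexHull ℝ (Q : Set Pt)) := hw.2
  obtain ⟨f, hf0, hfi, hfK⟩ := exists_support (convex_convexHull ℝ _) hne hw2
  set Q' := Q.filter (fun q => f q = f w) with hQ'
  have hwQ' : w ∈ convexHull ℝ (Q' : Set Pt) := by
    rw [Finset.mem_convexHull'] at hw1 ⊢
    obtain ⟨c, hc0, hc1, hcw⟩ := hw1
    have hsum : ∑ y ∈ Q, c y * (f w - f y) = 0 := by
      simp only [mul_sub, Finset.sum_sub_distrib, ← Finset.sum_mul, hc1]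
      have := congrArg f hcw
      simp only [map_sum, map_smul, smul_eq_mul] at this
      rw [this]; ring
    have hz := (Finset.sum_eq_zero_iff_of_nonneg (fun y hy => mul_nonneg (hc0 y hy)
      (sub_nonneg.2 (hfK y (subset_convexHull ℝ _ hy))))).1 hsum
    have hz' : ∀ y ∈ Q, f y ≠ f w → c y = 0 := by
      intro y hy hne
      rcases mul_eq_zero.1 (hz y hy) with h | h
      · exact h
      · exact absurd (by linarith) hne
    refine ⟨c, fun y hy => hc0 y (Finset.mem_filter.1 hy).1, ?_, ?_⟩
    · rw [← hc1, hQ', Finset.sum_filter_of_ne]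
      intro y hy h; by_contra h'; exact h (hz' y hy h')
    · rw [← hcw, hQ', Finset.sum_filter_of_ne]
      intro y hy h; by_contra h'; exact h (by rw [hz' y hy h', zero_smul])
  have hcard : Q'.card ≤ 2 := by
    by_contra hc
    push Not at hc
    obtain ⟨p, q, r, hp, hq, hr, h1, h2, h3⟩ := Finset.two_lt_card_iff.1 hc
    simp only [hQ', Finset.mem_filter] at hp hq hr
    exact P.gp (hQ _ hp.1) (hQ _ hq.1) (hQ _ hr.1) h1 h2 h3
      (crs_zero_of_level hf0 (by rw [hq.2, hp.2]) (by rw [hr.2, hp.2]))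
  have hc : Q'.card = 0 ∨ Q'.card = 1 ∨ Q'.card = 2 := by omega
  rcases hc with h | h | h
  · rw [Finset.card_eq_zero.1 h] at hwQ'; simp at hwQ'
  · obtain ⟨p, hp⟩ := Finset.card_eq_one.1 h
    rw [hp] at hwQ'
    simp at hwQ'
    left
    rw [hwQ']
    have : p ∈ Q' := by rw [hp]; simp
    exact (Finset.mem_filter.1 this).1
  · obtain ⟨p, q, hpq, hpq'⟩ := Finset.card_eq_two.1 h
    rw [hpq'] at hwQ'
    simp only [Finset.coe_insert, Finset.coe_singleton, convexHull_pair] at hwQ'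
    right
    have hp : p ∈ Q' := by rw [hpq']; simp
    have hq : q ∈ Q' := by rw [hpq']; simp
    simp only [hQ', Finset.mem_filter] at hp hq
    refine ⟨p, q, ⟨hp.1, hq.1, hpq, ?_⟩, hwQ'⟩
    intro z hz
    refine ⟨subset_closure ?_, ?_⟩
    · exact (convex_convexHull ℝ (Q : Set Pt)).segment_subset (subset_convexHull ℝ _ hp.1)
        (subset_convexHull ℝ _ hq.1) hz
    · intro hzi
      have := hfi z hzi
      obtain ⟨α, β, _, _, hs, rfl⟩ := hz
      simp only [map_add, map_smul, smul_eq_mul, hp.2, hq.2] at this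
      have : (α + β) * f w < f w := by linarith
      rw [hs] at this; linarith

lemma exists_frontier {K : Set Pt} (hK : IsClosed K) {x q : Pt} (hx : x ∈ interior K)
    (hq : q ∉ interior K) : ∃ y ∈ segment ℝ x q, y ∈ frontier K := by
  by_contra hc
  push Not at hc
  have hfr : ∀ y ∈ segment ℝ x q, y ∉ interior K → y ∈ Kᶜ := by
    intro y hy h1 h2
    exact hc y hy ⟨subset_closure h2, h1⟩
  obtain ⟨z, _, hz1, hz2⟩ := (convex_segment x q).isPreconnected (interior K) Kᶜ isOpen_interior
    hK.isOpen_compl (fun y hy => by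
      by_cases h : y ∈ interior K
      · exact Or.inl h
      · exact Or.inr (hfr y hy h))
    ⟨x, left_mem_segment ℝ _ _, hx⟩
    ⟨q, right_mem_segment ℝ _ _, hfr q (right_mem_segment ℝ _ _) hq⟩
  exact hz2 (interior_subset hz1)

/-- Trapping lemma: a chord meeting the interior of an empty convex polygon without crossing
its hull edges has both endpoints in the polygon. -/
lemma trap_aux (P : SimplePolygon) {Q : Finset Pt} (hQ : ∀ p ∈ Q, P.IsVtx p)
    (hemp : ∀ i, P.vtx i ∉ interior (convexHull ℝ (Q : Set Pt))) {p q x : Pt}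
    (hp : P.IsVtx p) (hq : P.IsVtx q)
    (hcomp : ∀ r t, IsHullEdgeOf Q r t → Compat s(r, t) s(p, q))
    (hx : x ∈ segment ℝ p q) (hxi : x ∈ interior (convexHull ℝ (Q : Set Pt))) : q ∈ Q := by
  have hqi : q ∉ interior (convexHull ℝ (Q : Set Pt)) := by
    obtain ⟨i, rfl⟩ := hq; exact hemp i
  have hpi : p ∉ interior (convexHull ℝ (Q : Set Pt)) := by
    obtain ⟨i, rfl⟩ := hp; exact hemp i
  obtain ⟨y, hy, hyf⟩ := exists_frontier (hull_closed Q) hxi hqi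
  have hyseg : y ∈ segment ℝ p q :=
    (convex_segment p q).segment_subset hx (right_mem_segment ℝ _ _) hy
  have hend : y = p ∨ y = q → y = q := by
    rintro (rfl | h)
    · exfalso
      have hxy : x = y := by
        obtain ⟨a, b, ha, hb, hab, hxe⟩ := hx
        obtain ⟨c, d, hc, hd, hcd, hye⟩ := hy
        by_cases hyq : y = q
        · subst hyq
          rw [← hxe, ← add_smul, hab, one_smul]
        have e : (c * b + d) • (q - y) = 0 := by
          have e1 : a = 1 - b := by linarith
          have e2 : c = 1 - d := by linarith
          have : (c * b + d) • (q - y) = (c • x + d • q) - y := by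
            rw [← hxe, e1, e2]; module
          rw [this, hye, sub_self]
        rcases smul_eq_zero.1 e with h | h
        · have hd0 : d = 0 := by nlinarith [mul_nonneg hc hb]
          have hc1 : c = 1 := by linarith
          rw [← hye, hc1, hd0]; simp
        · exact absurd (sub_eq_zero.1 h).symm hyq
      exact hpi (hxy ▸ hxi)
    · exact h
  rcases frontier_hull P hQ ⟨x, hxi⟩ hyf with h | ⟨r, t, hrt, hyrt⟩
  · rw [← hend (P.vtx_on_seg hp hq (hQ y h) hyseg)]; exact h
  · rcases hcomp r t hrt with h | h
    · exfalso
      have : x ∈ segment ℝ r t := by rw [← seg2_mk, h, seg2_mk]; exact hx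
      exact (hrt.2.2.2 this).2 hxi
    · have := h y ⟨hyrt, hyseg⟩
      simp only [Sym2.mem_iff] at this
      have hyq := hend this.2
      rw [← hyq]
      rcases this.1 with rfl | rfl
      · exact hrt.1
      · exact hrt.2.1

lemma trap (P : SimplePolygon) {Q : Finset Pt} (hQ : ∀ p ∈ Q, P.IsVtx p)
    (hemp : ∀ i, P.vtx i ∉ interior (convexHull ℝ (Q : Set Pt))) {p q x : Pt}
    (hp : P.IsVtx p) (hq : P.IsVtx q)
    (hcomp : ∀ r t, IsHullEdgeOf Q r t → Compat s(r, t) s(p, q))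
    (hx : x ∈ segment ℝ p q) (hxi : x ∈ interior (convexHull ℝ (Q : Set Pt))) :
    p ∈ Q ∧ q ∈ Q := by
  refine ⟨trap_aux P hQ hemp hq hp ?_ (by rwa [segment_symm]) hxi,
    trap_aux P hQ hemp hp hq hcomp hx hxi⟩
  intro r t h
  rw [Sym2.eq_swap (a := q)]
  exact hcomp r t h

/-- A pair of points of an empty polygon is a hull edge or a diagonal. -/
lemma hull_or_diag {Q : Finset Pt} {p q : Pt} (hp : p ∈ Q) (hq : q ∈ Q) (hpq : p ≠ q)
    (hpi : p ∉ interior (convexHull ℝ (Q : Set Pt)))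
    (hqi : q ∉ interior (convexHull ℝ (Q : Set Pt))) :
    IsHullEdgeOf Q p q ∨ openSegment ℝ p q ⊆ interior (convexHull ℝ (Q : Set Pt)) := by
  have hcv := convex_convexHull ℝ (Q : Set Pt)
  have hp' := subset_convexHull ℝ (Q : Set Pt) hp
  have hq' := subset_convexHull ℝ (Q : Set Pt) hq
  by_cases h : ∃ z ∈ openSegment ℝ p q, z ∈ interior (convexHull ℝ (Q : Set Pt))
  · right
    obtain ⟨z, hz, hzi⟩ := h
    intro y hy
    have hz' : z ∈ Set.range (AffineMap.lineMap p q : ℝ → Pt) := by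
      rw [openSegment_eq_image_lineMap] at hz
      exact Set.image_subset_range _ _ hz
    rcases openSegment_subset_union p q hz' hy with h1 | h1 | h1
    · rwa [h1]
    · exact hcv.openSegment_self_interior_subset_interior hp' hzi h1
    · exact hcv.openSegment_interior_self_subset_interior hzi hq' h1
  · left
    push Not at h
    refine ⟨hp, hq, hpq, fun y hy => ⟨subset_closure (hcv.segment_subset hp' hq' hy), ?_⟩⟩
    by_cases h1 : y = p
    · rwa [h1]
    by_cases h2 : y = q
    · rwa [h2]
    exact h y (mem_openSegment_of_ne_left_right (Ne.symm h1) (Ne.symm h2) hy)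

/-! ### Edges of triangulations -/

lemma finRotate_ne {n : ℕ} (hn : 3 ≤ n) (i : Fin n) : finRotate n i ≠ i := by
  obtain ⟨m, rfl⟩ : ∃ m, n = m + 1 := ⟨n - 1, by omega⟩
  rw [finRotate_succ_apply]
  intro h
  have h1 : (1 : Fin (m + 1)) = 0 := by simpa using h
  have := congrArg Fin.val h1
  rw [Fin.val_one', Fin.val_zero, Nat.mod_eq_of_lt (by omega)] at this
  omega

lemma SimplePolygon.vtx_mem_boundary (P : SimplePolygon) {p : Pt} (hp : P.IsVtx p) :
    p ∈ P.boundary := by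
  obtain ⟨i, rfl⟩ := hp
  exact Set.mem_iUnion.2 ⟨i, left_mem_segment ℝ _ _⟩

lemma SimplePolygon.IsDiagonal.mk' {P : SimplePolygon} {p q : Pt} (h : P.IsDiagonal s(p, q)) :
    P.IsVtx p ∧ P.IsVtx q ∧ openSegment ℝ p q ⊆ P.inside := by
  obtain ⟨i, j, he, h⟩ := h
  rw [Sym2.eq_iff] at he
  rcases he with ⟨rfl, rfl⟩ | ⟨rfl, rfl⟩
  · exact ⟨⟨i, rfl⟩, ⟨j, rfl⟩, h⟩
  · exact ⟨⟨j, rfl⟩, ⟨i, rfl⟩, by rwa [openSegment_symm]⟩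

lemma SimplePolygon.isDiagonal_of {P : SimplePolygon} {p q : Pt} (hp : P.IsVtx p) (hq : P.IsVtx q)
    (h : openSegment ℝ p q ⊆ P.inside) : P.IsDiagonal s(p, q) := by
  obtain ⟨i, rfl⟩ := hp
  obtain ⟨j, rfl⟩ := hq
  exact ⟨i, j, rfl, h⟩

lemma SimplePolygon.IsBoundaryEdge.mk' {P : SimplePolygon} {p q : Pt}
    (h : P.IsBoundaryEdge s(p, q)) : P.IsVtx p ∧ P.IsVtx q ∧ segment ℝ p q ⊆ P.boundary := by
  obtain ⟨i, he⟩ := h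
  have hb : segment ℝ (P.vtx i) (P.vtx (finRotate P.n i)) ⊆ P.boundary :=
    Set.subset_iUnion (fun i => segment ℝ (P.vtx i) (P.vtx (finRotate P.n i))) i
  rw [Sym2.eq_iff] at he
  rcases he with ⟨rfl, rfl⟩ | ⟨rfl, rfl⟩
  · exact ⟨⟨i, rfl⟩, ⟨_, rfl⟩, hb⟩
  · exact ⟨⟨_, rfl⟩, ⟨i, rfl⟩, by rwa [segment_symm]⟩

lemma PolyTriangulation.IsEdgeOrDiag.vtx {P : SimplePolygon} {D : PolyTriangulation P} {p q : Pt}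
    (h : D.IsEdgeOrDiag s(p, q)) : P.IsVtx p ∧ P.IsVtx q := by
  rcases h with h | h
  · exact ⟨h.mk'.1, h.mk'.2.1⟩
  · exact ⟨(D.isDiag _ h).mk'.1, (D.isDiag _ h).mk'.2.1⟩

lemma PolyTriangulation.IsEdgeOrDiag.ne {P : SimplePolygon} {D : PolyTriangulation P} {p q : Pt}
    (h : D.IsEdgeOrDiag s(p, q)) : p ≠ q := by
  rintro rfl
  rcases h with h | h
  · obtain ⟨i, he⟩ := h
    rw [Sym2.eq_iff] at he
    have : P.vtx (finRotate P.n i) = P.vtx i := by rcases he with h | h <;> rw [← h.1, ← h.2]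
    exact finRotate_ne P.three_le i (P.inj this)
  · have := (D.isDiag _ h).mk'
    have hm : p ∈ P.inside := this.2.2 (by rw [openSegment_same]; rfl)
    exact hm.1 (P.vtx_mem_boundary this.1)

lemma compat_diag_boundary {P : SimplePolygon} {e f : Sym2 Pt} (he : P.IsDiagonal e)
    (hf : P.IsBoundaryEdge f) : Compat e f := by
  induction e with | h p q => ?_
  induction f with | h r t => ?_
  have he := he.mk'
  have hf := hf.mk'
  by_contra hc
  obtain ⟨y, hy1, hy2⟩ := P.cross_of_not_compat he.1 he.2.1 hf.1 hf.2.1 hc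
  exact (he.2.2 hy1).1 (hf.2.2 (openSegment_subset_segment _ _ _ hy2))

lemma PolyTriangulation.compat {P : SimplePolygon} (D : PolyTriangulation P) {e f : Sym2 Pt}
    (he : D.IsEdgeOrDiag e) (hf : D.IsEdgeOrDiag f) : Compat e f := by
  by_cases hef : e = f
  · exact Or.inl hef
  rcases he with he | he <;> rcases hf with hf | hf
  · obtain ⟨i, rfl⟩ := he
    obtain ⟨j, rfl⟩ := hf
    exact Or.inr fun x hx => P.noncrossing i j hef x hx
  · exact (compat_diag_boundary (D.isDiag _ hf) he).symm
  · exact compat_diag_boundary (D.isDiag _ he) hf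
  · exact Or.inr (D.noncrossing e he f hf hef)

lemma PolyTriangulation.mem_of_compat {P : SimplePolygon} (D : PolyTriangulation P) {e : Sym2 Pt}
    (he : P.IsDiagonal e) (h : ∀ f ∈ D.diags, Compat e f) : e ∈ D.diags :=
  D.maximal e he fun f hf hne => (h f hf).resolve_left hne

/-! ### Finiteness, extension and counting -/

def allDiags (P : SimplePolygon) : Finset (Sym2 Pt) :=
  (Finset.univ.image fun ij : Fin P.n × Fin P.n => s(P.vtx ij.1, P.vtx ij.2)).filter P.IsDiagonal

lemma mem_allDiags {P : SimplePolygon} {e : Sym2 Pt} : e ∈ allDiags P ↔ P.IsDiagonal e := by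
  unfold allDiags
  rw [Finset.mem_filter]
  refine ⟨fun h => h.2, fun h => ⟨?_, h⟩⟩
  obtain ⟨i, j, rfl, _⟩ := h
  exact Finset.mem_image.2 ⟨(i, j), Finset.mem_univ _, rfl⟩

lemma PolyTriangulation.ext' {P : SimplePolygon} {D D' : PolyTriangulation P}
    (h : D.diags = D'.diags) : D = D' := by
  cases D; cases D'; simp only at h; subst h; rfl

instance (P : SimplePolygon) : Finite (PolyTriangulation P) := by
  refine Finite.of_injective (β := (allDiags P).powerset)
    (fun D => ⟨D.diags, Finset.mem_powerset.2 fun e he => mem_allDiags.2 (D.isDiag e he)⟩) ?_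
  intro D D' h
  exact PolyTriangulation.ext' (by simpa using h)

/-- Every non-crossing set of diagonals extends to a triangulation. -/
lemma exists_extension {P : SimplePolygon} (S : Finset (Sym2 Pt)) (h1 : ∀ e ∈ S, P.IsDiagonal e)
    (h2 : ∀ e ∈ S, ∀ f ∈ S, Compat e f) : ∃ T : PolyTriangulation P, S ⊆ T.diags := by
  let A := (allDiags P).powerset.filter fun U => S ⊆ U ∧ ∀ e ∈ U, ∀ f ∈ U, Compat e f
  have hA : A.Nonempty := ⟨S, Finset.mem_filter.2 ⟨Finset.mem_powerset.2 fun e he =>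
    mem_allDiags.2 (h1 e he), Finset.Subset.refl _, h2⟩⟩
  obtain ⟨U, hU, hmax⟩ := A.exists_max_image Finset.card hA
  simp only [A, Finset.mem_filter, Finset.mem_powerset] at hU
  refine ⟨⟨U, fun e he => mem_allDiags.1 (hU.1 he), ?_, ?_⟩, hU.2.1⟩
  · intro e he f hf hne
    exact (hU.2.2 e he f hf).resolve_left hne
  · intro e he hcomp
    by_contra heU
    have hc : ∀ f ∈ U, Compat e f := fun f hf => Or.inr (hcomp f hf (by rintro rfl; exact heU hf))
    have := hmax (insert e U) (Finset.mem_filter.2 ⟨Finset.mem_powerset.2 ?_, ?_, ?_⟩)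
    · rw [Finset.card_insert_of_notMem heU] at this; omega
    · exact Finset.insert_subset (mem_allDiags.2 he) hU.1
    · exact hU.2.1.trans (Finset.subset_insert _ _)
    · intro f hf g hg
      rw [Finset.mem_insert] at hf hg
      rcases hf with rfl | hf <;> rcases hg with rfl | hg
      · exact Or.inl rfl
      · exact hc g hg
      · exact (hc f hf).symm
      · exact hU.2.2 f hf g hg

/-- The number of triangulations containing a given set of diagonals. -/
def cnt (P : SimplePolygon) (S : Finset (Sym2 Pt)) : ℕ :=
  Set.ncard {T : PolyTriangulation P | S ⊆ T.diags}

lemma cnt_le (P : SimplePolygon) (S : Finset (Sym2 Pt)) : cnt P S ≤ polyTriCount P := by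
  unfold cnt polyTriCount
  rw [← Set.ncard_univ]
  exact Set.ncard_le_ncard (Set.subset_univ _)

lemma cnt_mono (P : SimplePolygon) {S S' : Finset (Sym2 Pt)} (h : S ⊆ S') :
    cnt P S' ≤ cnt P S :=
  Set.ncard_le_ncard (fun _ hT => h.trans hT) (Set.toFinite _)

lemma cnt_pos {P : SimplePolygon} (S : Finset (Sym2 Pt)) (h1 : ∀ e ∈ S, P.IsDiagonal e)
    (h2 : ∀ e ∈ S, ∀ f ∈ S, Compat e f) : 1 ≤ cnt P S := by
  obtain ⟨T, hT⟩ := exists_extension S h1 h2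
  exact (Set.ncard_pos (Set.toFinite _)).2 ⟨T, hT⟩

lemma cnt_add {P : SimplePolygon} {S S₁ S₂ : Finset (Sym2 Pt)} (h1 : S ⊆ S₁) (h2 : S ⊆ S₂)
    {e f : Sym2 Pt} (he : e ∈ S₁) (hf : f ∈ S₂) (hef : ¬ Compat e f) :
    cnt P S₁ + cnt P S₂ ≤ cnt P S := by
  unfold cnt
  rw [← Set.ncard_union_eq _ (Set.toFinite _) (Set.toFinite _)]
  · exact Set.ncard_le_ncard (Set.union_subset (fun _ hT => h1.trans hT) fun _ hT => h2.trans hT)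
      (Set.toFinite _)
  · rw [Set.disjoint_left]
    intro T hT1 hT2
    exact hef (T.compat (Or.inr (hT1 he)) (Or.inr (hT2 hf)))

lemma cnt_add3 {P : SimplePolygon} {S S₁ S₂ S₃ : Finset (Sym2 Pt)} (h1 : S ⊆ S₁) (h2 : S ⊆ S₂)
    (h3 : S ⊆ S₃) {e f e' g f' g' : Sym2 Pt} (he : e ∈ S₁) (hf : f ∈ S₂) (hef : ¬ Compat e f)
    (he' : e' ∈ S₁) (hg : g ∈ S₃) (heg : ¬ Compat e' g)
    (hf' : f' ∈ S₂) (hg' : g' ∈ S₃) (hfg : ¬ Compat f' g') :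
    cnt P S₁ + cnt P S₂ + cnt P S₃ ≤ cnt P S := by
  unfold cnt
  rw [← Set.ncard_union_eq _ (Set.toFinite _) (Set.toFinite _),
    ← Set.ncard_union_eq _ (Set.toFinite _) (Set.toFinite _)]
  · exact Set.ncard_le_ncard (Set.union_subset (Set.union_subset (fun _ hT => h1.trans hT)
      fun _ hT => h2.trans hT) fun _ hT => h3.trans hT) (Set.toFinite _)
  · rw [Set.disjoint_left]
    rintro T (hT1 | hT2) hT3
    · exact heg (T.compat (Or.inr (hT1 he')) (Or.inr (hT3 hg)))
    · exact hfg (T.compat (Or.inr (hT2 hf')) (Or.inr (hT3 hg')))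
  · rw [Set.disjoint_left]
    intro T hT1 hT2
    exact hef (T.compat (Or.inr (hT1 he)) (Or.inr (hT2 hf)))

/-! ### Triangular faces and flips -/

lemma tri_interior {a b c : Pt} (h : 0 < crs a b c) {y : Pt} (h1 : 0 < crs a b y)
    (h2 : 0 < crs b c y) (h3 : 0 < crs c a y) : y ∈ interior (convexHull ℝ ({a, b, c} : Set Pt)) := by
  have hsub : {w : Pt | 0 < crs a b w ∧ 0 < crs b c w ∧ 0 < crs c a w} ⊆
      convexHull ℝ ({a, b, c} : Set Pt) := by
    rintro w ⟨e1, e2, e3⟩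
    have hsum : crs b c w + crs c a w + crs a b w = crs a b c := by unfold crs; ring
    have hw : w = ∑ i : Fin 3, (![crs b c w / crs a b c, crs c a w / crs a b c,
        crs a b w / crs a b c] i) • (![a, b, c] i) := by
      rw [Fin.sum_univ_three]
      simp only [Matrix.cons_val_zero, Matrix.cons_val_one, Matrix.cons_val]
      ext
      · simp only [Prod.fst_add, Prod.smul_fst, smul_eq_mul]
        field_simp
        unfold crs; ring
      · simp only [Prod.snd_add, Prod.smul_snd, smul_eq_mul]
        field_simp
        unfold crs; ring
    rw [hw]
    apply (convex_convexHull ℝ ({a, b, c} : Set Pt)).sum_mem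
    · intro i _
      fin_cases i <;> simp <;> positivity
    · rw [Fin.sum_univ_three]
      simp only [Matrix.cons_val_zero, Matrix.cons_val_one, Matrix.cons_val]
      field_simp
      exact hsum
    · intro i _
      apply subset_convexHull
      fin_cases i <;> simp
  refine interior_maximal hsub ?_ ⟨h1, h2, h3⟩
  exact (isOpen_lt continuous_const (crs_cont a b)).inter
    ((isOpen_lt continuous_const (crs_cont b c)).inter (isOpen_lt continuous_const (crs_cont c a)))

lemma tri_interior_of_open {a b c z y : Pt} (h : crs a b c ≠ 0) (hz : z ∈ openSegment ℝ a b)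
    (hy : y ∈ openSegment ℝ c z) : y ∈ interior (convexHull ℝ ({a, b, c} : Set Pt)) := by
  wlog hpos : 0 < crs a b c generalizing a b
  · have hlt : crs a b c < 0 := lt_of_le_of_ne (not_lt.1 hpos) h
    have h' : crs b a c ≠ 0 := by rw [crs_swap]; exact neg_ne_zero.2 h
    have := this (a := b) (b := a) h' (by rwa [openSegment_symm]) (by rw [crs_swap]; linarith)
    rwa [Set.insert_comm] at this
  obtain ⟨α, β, hα, hβ, hαβ, rfl⟩ := hz
  obtain ⟨γ, δ, hγ, hδ, hγδ, rfl⟩ := hy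
  apply tri_interior hpos <;>
    rw [crs_affine _ _ _ _ _ _ hγδ, crs_affine _ _ _ _ _ _ hαβ]
  · rw [crs_left, crs_right]; simp; positivity
  · rw [crs_right, crs_left, crs_rot]; simp; positivity
  · rw [crs_right, crs_left, crs_rot']; simp; positivity

lemma side_not_interior {K : Set Pt} {u w t y : Pt} (huw : u ≠ w)
    (hK : ∀ q ∈ K, q = u ∨ q = w ∨ q = t) (hy : y ∈ segment ℝ u w) :
    y ∉ interior (convexHull ℝ K) := by
  intro hi
  have h0 := crs_of_mem_segment hy
  rcases le_total 0 (crs u w t) with h | h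
  · have := interior_halfplane (u := u) (w := w) huw (fun q hq => by
      rcases hK q hq with rfl | rfl | rfl
      · rw [crs_left]
      · rw [crs_right]
      · exact h) hi
    linarith
  · have := interior_halfplane (u := w) (w := u) huw.symm (fun q hq => by
      rcases hK q hq with rfl | rfl | rfl
      · rw [crs_right]
      · rw [crs_left]
      · rw [crs_swap]; linarith) hi
    rw [crs_swap] at this
    linarith

/-- No edge of the triangulation enters the interior of a face. -/
lemma face_empty {P : SimplePolygon} {T : PolyTriangulation P} {a b c p q y : Pt}
    (hf : T.IsFace a b c) (hs : T.IsEdgeOrDiag s(p, q)) (hy : y ∈ segment ℝ p q) :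
    y ∉ interior (convexHull ℝ ({a, b, c} : Set Pt)) := by
  intro hi
  obtain ⟨ha, hb, hc, hab, hbc, hac, hemp⟩ := hf
  have hcoe : ((({a, b, c} : Finset Pt)) : Set Pt) = {a, b, c} := by simp
  have := trap P (Q := {a, b, c}) (p := p) (q := q) (x := y) ?_ (by rwa [hcoe]) hs.vtx.1 hs.vtx.2
    ?_ hy (by rwa [hcoe])
  · have hne := hs.ne
    simp only [Finset.mem_insert, Finset.mem_singleton] at this
    obtain ⟨h1, h2⟩ := this
    have main : ∃ t, ∀ r ∈ ({a, b, c} : Set Pt), r = p ∨ r = q ∨ r = t := by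
      simp only [Set.mem_insert_iff, Set.mem_singleton_iff]
      rcases h1 with rfl | rfl | rfl <;> rcases h2 with rfl | rfl | rfl <;>
        first | exact absurd rfl hne | exact ⟨a, by tauto⟩ | exact ⟨b, by tauto⟩ | exact ⟨c, by tauto⟩
    obtain ⟨t, ht⟩ := main
    exact side_not_interior hne ht hy hi
  · intro r hr
    simp only [Finset.mem_insert, Finset.mem_singleton] at hr
    rcases hr with rfl | rfl | rfl <;> assumption
  · rintro r t ⟨hr, ht, hrt, -⟩
    refine T.compat ?_ hs
    simp only [Finset.mem_insert, Finset.mem_singleton] at hr ht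
    rcases hr with rfl | rfl | rfl <;> rcases ht with rfl | rfl | rfl <;>
      first
        | exact absurd rfl hrt
        | assumption
        | (rw [Sym2.eq_swap]; assumption)

lemma inside_of_connected {P : SimplePolygon} {U : Set Pt} (hU : IsPreconnected U)
    (hb : ∀ y ∈ U, y ∉ P.boundary) {z : Pt} (hz : z ∈ U) (hzi : z ∈ P.inside) : U ⊆ P.inside := by
  intro y hy
  refine ⟨hb y hy, ?_⟩
  have : y ∈ connectedComponentIn P.boundaryᶜ z :=
    hU.subset_connectedComponentIn hz hb hy
  rw [← connectedComponentIn_eq this]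
  exact hzi.2

lemma face_crs {P : SimplePolygon} {T : PolyTriangulation P} {a b c : Pt}
    (hf : T.IsFace a b c) : crs a b c ≠ 0 :=
  P.gp hf.1 hf.2.1 hf.2.2.1 hf.2.2.2.1.ne hf.2.2.2.2.2.1.ne hf.2.2.2.2.1.ne

lemma flip_points {P : SimplePolygon} {T : PolyTriangulation P} {a b c d z y : Pt}
    (hc : T.IsFace a b c) (hd : T.IsFace a b d) (hz1 : z ∈ openSegment ℝ a b)
    (hz2 : z ∈ openSegment ℝ c d) (hy : y ∈ openSegment ℝ c d) :
    y = z ∨ y ∈ interior (convexHull ℝ ({a, b, c} : Set Pt)) ∨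
      y ∈ interior (convexHull ℝ ({a, b, d} : Set Pt)) := by
  have hz' : z ∈ Set.range (AffineMap.lineMap c d : ℝ → Pt) := by
    rw [openSegment_eq_image_lineMap] at hz2
    exact Set.image_subset_range _ _ hz2
  rcases openSegment_subset_union c d hz' hy with h1 | h1 | h1
  · exact Or.inl h1
  · exact Or.inr (Or.inl (tri_interior_of_open (face_crs hc) hz1 h1))
  · exact Or.inr (Or.inr (tri_interior_of_open (face_crs hd) hz1 (by rwa [openSegment_symm])))

lemma flip_facts {P : SimplePolygon} {T : PolyTriangulation P} {a b c d z : Pt}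
    (he : s(a, b) ∈ T.diags) (hc : T.IsFace a b c) (hd : T.IsFace a b d)
    (hz1 : z ∈ openSegment ℝ a b) (hz2 : z ∈ openSegment ℝ c d) :
    P.IsDiagonal s(c, d) ∧ ¬ Compat s(a, b) s(c, d) ∧
      ∀ f ∈ T.diags, f ≠ s(a, b) → Compat s(c, d) f := by
  have hzin : z ∈ P.inside := (T.isDiag _ he).mk'.2.2 hz1
  refine ⟨P.isDiagonal_of hc.2.2.1 hd.2.2.1 ?_, ?_, ?_⟩
  · refine inside_of_connected (convex_openSegment c d).isPreconnected ?_ hz2 hzin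
    intro y hy hyb
    obtain ⟨i, hi⟩ := Set.mem_iUnion.1 hyb
    have hbe : T.IsEdgeOrDiag s(P.vtx i, P.vtx (finRotate P.n i)) := Or.inl ⟨i, rfl⟩
    rcases flip_points hc hd hz1 hz2 hy with rfl | h | h
    · exact hzin.1 hyb
    · exact face_empty hc hbe hi h
    · exact face_empty hd hbe hi h
  · exact not_compat_of_open hc.2.2.2.1.ne hc.2.2.2.2.2.1.ne hd.2.2.2.2.2.1.ne hz1 hz2
  · intro f hf hne
    induction f with | h p q => ?_
    by_contra hcomp
    have hfv := (T.isDiag _ hf).mk'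
    obtain ⟨y, hy1, hy2⟩ := P.cross_of_not_compat hc.2.2.1 hd.2.2.1 hfv.1 hfv.2.1 hcomp
    have hy2' := openSegment_subset_segment _ _ _ hy2
    rcases flip_points hc hd hz1 hz2 hy1 with rfl | h | h
    · have habv := (T.isDiag _ he).mk'
      have := T.compat (Or.inr hf) (Or.inr he)
      rcases this with h | h
      · exact hne h
      · have hm := (h y ⟨hy2', openSegment_subset_segment _ _ _ hz1⟩).1
        have hv : P.IsVtx y := by
          rw [Sym2.mem_iff] at hm
          rcases hm with rfl | rfl
          · exact hfv.1
          · exact hfv.2.1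
        exact hzin.1 (P.vtx_mem_boundary hv)
    · exact face_empty hc (Or.inr hf) hy2' h
    · exact face_empty hd (Or.inr hf) hy2' h

/-- Flip data of a diagonal. -/
def FlipData {P : SimplePolygon} (D : PolyTriangulation P) (a b c d : Pt) : Prop :=
  D.IsFace a b c ∧ D.IsFace a b d ∧ (openSegment ℝ a b ∩ openSegment ℝ c d).Nonempty

def nbrs (a b c d : Pt) : Finset (Sym2 Pt) := {s(a, c), s(b, c), s(a, d), s(b, d)}

lemma face_transfer {P : SimplePolygon} {D T : PolyTriangulation P} {a b c : Pt}
    (h : D.IsFace a b c)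
    (hT : ∀ e ∈ D.diags, e = s(a, b) ∨ e = s(a, c) ∨ e = s(b, c) → e ∈ T.diags) :
    T.IsFace a b c := by
  obtain ⟨ha, hb, hc, hab, hbc, hac, hemp⟩ := h
  exact ⟨ha, hb, hc, hab.imp_right fun h => hT _ h (by simp),
    hbc.imp_right fun h => hT _ h (by simp), hac.imp_right fun h => hT _ h (by simp), hemp⟩

lemma cnt_flip {P : SimplePolygon} (D : PolyTriangulation P) {a b c d : Pt}
    (he : s(a, b) ∈ D.diags) (hfl : FlipData D a b c d) {S S' : Finset (Sym2 Pt)}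
    (hS : s(a, b) ∉ S) (hSS' : S ⊆ S') (heS' : s(a, b) ∈ S')
    (hn : ∀ f ∈ nbrs a b c d, f ∈ D.diags → f ∈ S') :
    cnt P (insert s(a, b) S) + cnt P S' ≤ cnt P S := by
  obtain ⟨hc, hd, z, hz1, hz2⟩ := hfl
  have key : ∀ T : PolyTriangulation P, S' ⊆ T.diags → ∃ T' : PolyTriangulation P,
      insert s(c, d) (T.diags.erase s(a, b)) ⊆ T'.diags ∧ s(a, b) ∉ T'.diags := by
    intro T hT
    have heT := hT heS'
    have hcT : T.IsFace a b c := by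
      refine face_transfer hc fun f hf h => ?_
      rcases h with rfl | rfl | rfl
      · exact heT
      · exact hT (hn _ (by simp [nbrs]) hf)
      · exact hT (hn _ (by simp [nbrs]) hf)
    have hdT : T.IsFace a b d := by
      refine face_transfer hd fun f hf h => ?_
      rcases h with rfl | rfl | rfl
      · exact heT
      · exact hT (hn _ (by simp [nbrs]) hf)
      · exact hT (hn _ (by simp [nbrs]) hf)
    obtain ⟨h1, h2, h3⟩ := flip_facts heT hcT hdT hz1 hz2
    obtain ⟨T', hT'⟩ := exists_extension (P := P) (insert s(c, d) (T.diags.erase s(a, b)))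
      (by
        intro f hf
        rw [Finset.mem_insert, Finset.mem_erase] at hf
        rcases hf with rfl | hf
        · exact h1
        · exact T.isDiag _ hf.2)
      (by
        intro f hf g hg
        rw [Finset.mem_insert, Finset.mem_erase] at hf hg
        rcases hf with rfl | hf <;> rcases hg with rfl | hg
        · exact Or.inl rfl
        · exact h3 g hg.2 hg.1
        · exact (h3 f hf.2 hf.1).symm
        · exact T.compat (Or.inr hf.2) (Or.inr hg.2))
    exact ⟨T', hT', fun h => h2 (T'.compat (Or.inr h) (Or.inr (hT' (Finset.mem_insert_self _ _))))⟩
  let φ : PolyTriangulation P → PolyTriangulation P := fun T =>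
    if h : S' ⊆ T.diags then (key T h).choose else T
  have hφ : ∀ T, S' ⊆ T.diags → insert s(c, d) (T.diags.erase s(a, b)) ⊆ (φ T).diags ∧
      s(a, b) ∉ (φ T).diags := by
    intro T h
    simp only [φ, dif_pos h]
    exact (key T h).choose_spec
  have hinj : Set.InjOn φ {T : PolyTriangulation P | S' ⊆ T.diags} := by
    intro T₁ h₁ T₂ h₂ heq
    have e1 := (hφ T₁ h₁).1
    have e2 := (hφ T₂ h₂).1
    rw [← heq] at e2
    have aux : ∀ T₁ T₂ : PolyTriangulation P, S' ⊆ T₁.diags → S' ⊆ T₂.diags →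
        insert s(c, d) (T₁.diags.erase s(a, b)) ⊆ (φ T₁).diags →
        insert s(c, d) (T₂.diags.erase s(a, b)) ⊆ (φ T₁).diags → T₁.diags ⊆ T₂.diags := by
      intro T₁ T₂ h₁ h₂ e1 e2 f hf
      refine T₂.mem_of_compat (T₁.isDiag f hf) fun g hg => ?_
      by_cases hfe : f = s(a, b)
      · subst hfe
        exact T₂.compat (Or.inr (h₂ heS')) (Or.inr hg)
      by_cases hge : g = s(a, b)
      · subst hge
        exact T₁.compat (Or.inr hf) (Or.inr (h₁ heS'))
      exact (φ T₁).compat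
        (Or.inr (e1 (Finset.mem_insert_of_mem (Finset.mem_erase.2 ⟨hfe, hf⟩))))
        (Or.inr (e2 (Finset.mem_insert_of_mem (Finset.mem_erase.2 ⟨hge, hg⟩))))
    apply PolyTriangulation.ext'
    refine Finset.Subset.antisymm (aux T₁ T₂ h₁ h₂ e1 e2) (aux T₂ T₁ h₂ h₁ ?_ ?_)
    · rw [← heq]; exact e2
    · rw [← heq]; exact e1
  unfold cnt
  rw [← Set.ncard_image_of_injOn hinj, ← Set.ncard_union_eq _ (Set.toFinite _) (Set.toFinite _)]
  · refine Set.ncard_le_ncard (Set.union_subset ?_ ?_) (Set.toFinite _)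
    · intro T hT
      exact (Finset.subset_insert _ _).trans hT
    · rintro _ ⟨T, hT, rfl⟩
      intro f hf
      exact (hφ T hT).1 (Finset.mem_insert_of_mem (Finset.mem_erase.2
        ⟨fun h => hS (h ▸ hf), hT (hSS' hf)⟩))
  · rw [Set.disjoint_left]
    rintro _ hT1 ⟨T, hT, rfl⟩
    exact (hφ T hT).2 (hT1 (Finset.mem_insert_self _ _))


/-! ### The root -/

lemma root_facts {x : ℝ} (hx : 1 + 4 * x ^ 2 - 4 * x ^ 3 = 0) : 1 < x ∧ x < 6 / 5 := by
  have h1 : 4 * x ^ 2 * (x - 1) = 1 := by linarith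
  have h2 : 1 < x := by
    by_contra h
    have := mul_nonneg (by positivity : 0 ≤ 4 * x ^ 2) (by linarith : 0 ≤ 1 - x)
    linarith
  refine ⟨h2, ?_⟩
  by_contra h
  push Not at h
  nlinarith [mul_nonneg (by linarith : (0:ℝ) ≤ x - 6/5) (by linarith : (0:ℝ) ≤ x), sq_nonneg x]

def HH (x : ℝ) (n : ℕ) : ℝ := if n ≤ 3 then 1 else 2 ^ (n - 3) * x ^ (n - 4)

lemma HH_pos {x : ℝ} (h : 0 < x) (n : ℕ) : 0 < HH x n := by
  unfold HH; split_ifs <;> positivity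

lemma HH_small {x : ℝ} {n : ℕ} (h : n ≤ 3) : HH x n = 1 := if_pos h

lemma HH_four (x : ℝ) : HH x 4 = 2 := by simp [HH]

lemma HH_add (x : ℝ) (m : ℕ) : HH x (m + 4) = 2 ^ (m + 1) * x ^ m := by
  simp [HH]

lemma HH_rec {x : ℝ} (hx : 1 + 4 * x ^ 2 - 4 * x ^ 3 = 0) (m : ℕ) :
    HH x (m + 5) ≤ 2 * HH x (m + 4) + HH x (m + 3) := by
  obtain ⟨h1, h2⟩ := root_facts hx
  rcases m with _ | m
  · simp only [zero_add]
    rw [HH_four, HH_small le_rfl, show 5 = 1 + 4 from rfl, HH_add]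
    norm_num; linarith
  · rw [show m + 1 + 5 = (m + 2) + 4 by ring, show m + 1 + 3 = m + 4 by ring, HH_add, HH_add, HH_add]
    have hb : 4 * x ^ 2 ≤ 4 * x + 1 := by
      have : 4 * x ^ 2 * (x - 1) = 1 := by linarith
      have h3 : x * (4 * x ^ 2 - 4 * x) = 1 := by linarith
      nlinarith
    have hp : (0:ℝ) ≤ 2 ^ (m + 1) * x ^ m := by positivity
    have := mul_le_mul_of_nonneg_left hb hp
    calc _ = 2 ^ (m + 1) * x ^ m * (4 * x ^ 2) := by ring
      _ ≤ _ := this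
      _ = _ := by ring

/-! ### Convex lists -/

def CCW (L : List Pt) : Prop := L.Triplewise fun a b c => 0 < crs a b c

lemma CCW.sublist {L L' : List Pt} (h : L'.Sublist L) (hL : CCW L) : CCW L' := by
  unfold CCW at *
  induction h with
  | slnil => exact hL
  | cons a h ih => exact ih (List.triplewise_cons.1 hL).2
  | cons_cons a h ih =>
    rw [List.triplewise_cons] at hL ⊢
    exact ⟨hL.1.sublist h, ih hL.2⟩

def Sepd (L : List Pt) (p q : Pt) : Prop :=
  p ∈ L ∧ q ∈ L ∧ (∃ r ∈ L, 0 < crs p q r) ∧ ∃ t ∈ L, crs p q t < 0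

lemma Sepd.mono {L L' : List Pt} (h : L' ⊆ L) {p q : Pt} (hs : Sepd L' p q) : Sepd L p q := by
  obtain ⟨h1, h2, ⟨r, h3, h4⟩, t, h5, h6⟩ := hs
  exact ⟨h h1, h h2, ⟨r, h h3, h4⟩, t, h h5, h6⟩

structure Good (P : SimplePolygon) (S : Finset (Sym2 Pt)) (Ls : List (List Pt)) : Prop where
  diag : ∀ e ∈ S, P.IsDiagonal e
  comp : ∀ e ∈ S, ∀ f ∈ S, Compat e f
  ccw : ∀ L ∈ Ls, CCW L
  sepd : ∀ L ∈ Ls, ∀ p q, Sepd L p q → P.IsDiagonal s(p, q) ∧ ∀ e ∈ S, Compat s(p, q) e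
  pw : Ls.Pairwise fun L L' => ∀ p q r t, Sepd L p q → Sepd L' r t → Compat s(p, q) s(r, t)

lemma Good.step {P : SimplePolygon} {S : Finset (Sym2 Pt)} {L : List Pt} {Ls : List (List Pt)}
    (h : Good P S (L :: Ls)) {L' : List Pt} (hL : L'.Sublist L) {A : Finset (Sym2 Pt)}
    (hA : ∀ e ∈ A, ∃ p q, e = s(p, q) ∧ Sepd L p q ∧ ∀ r ∈ L', r = p ∨ r = q ∨ 0 < crs p q r)
    (hAA : ∀ e ∈ A, ∀ f ∈ A, Compat e f) : Good P (A ∪ S) (L' :: Ls) := by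
  have hpw := List.pairwise_cons.1 h.pw
  have hself : L ∈ L :: Ls := List.mem_cons_self
  refine ⟨?_, ?_, ?_, ?_, ?_⟩
  · intro e he
    rcases Finset.mem_union.1 he with he | he
    · obtain ⟨p, q, rfl, hs, -⟩ := hA e he
      exact (h.sepd L hself p q hs).1
    · exact h.diag e he
  · have aux : ∀ e ∈ A, ∀ f ∈ S, Compat e f := by
      intro e he f hf
      obtain ⟨p, q, rfl, hs, -⟩ := hA e he
      exact (h.sepd L hself p q hs).2 f hf
    intro e he f hf
    rcases Finset.mem_union.1 he with he | he <;> rcases Finset.mem_union.1 hf with hf | hf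
    · exact hAA e he f hf
    · exact aux e he f hf
    · exact (aux f hf e he).symm
    · exact h.comp e he f hf
  · intro M hM
    rcases List.mem_cons.1 hM with rfl | hM
    · exact (h.ccw L hself).sublist hL
    · exact h.ccw M (List.mem_cons_of_mem _ hM)
  · intro M hM p q hs
    rcases List.mem_cons.1 hM with rfl | hM
    · have := h.sepd L hself p q (hs.mono hL.subset)
      refine ⟨this.1, fun e he => ?_⟩
      rcases Finset.mem_union.1 he with he | he
      · obtain ⟨u, w, rfl, -, hside⟩ := hA e he
        have side : ∀ r ∈ M, 0 ≤ crs u w r ∧ (crs u w r = 0 → r = u ∨ r = w) := by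
          intro r hr
          rcases hside r hr with rfl | rfl | h
          · exact ⟨(crs_left _ _).ge, fun _ => Or.inl rfl⟩
          · exact ⟨(crs_right _ _).ge, fun _ => Or.inr rfl⟩
          · exact ⟨h.le, fun h0 => absurd h0 h.ne'⟩
        exact (compat_of_side (side p hs.1).1 (side q hs.2.1).1 (side p hs.1).2
          (side q hs.2.1).2).symm
      · exact this.2 e he
    · have := h.sepd M (List.mem_cons_of_mem _ hM) p q hs
      refine ⟨this.1, fun e he => ?_⟩
      rcases Finset.mem_union.1 he with he | he
      · obtain ⟨u, w, rfl, hs', -⟩ := hA e he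
        exact (hpw.1 M hM u w p q hs' hs).symm
      · exact this.2 e he
  · refine List.pairwise_cons.2 ⟨fun M hM p q r t hs hs' => ?_, hpw.2⟩
    exact hpw.1 M hM p q r t (hs.mono hL.subset) hs'

lemma crs_pos_rot {a b c : Pt} (h : 0 < crs a b c) : 0 < crs b c a := by rwa [crs_rot]
lemma crs_pos_rot' {a b c : Pt} (h : 0 < crs a b c) : 0 < crs c a b := by rwa [crs_rot']
lemma crs_neg_swap {a b c : Pt} (h : 0 < crs a b c) : crs a c b < 0 := by
  rw [crs_swap']; linarith

theorem good_count {x : ℝ} (hx : 1 + 4 * x ^ 2 - 4 * x ^ 3 = 0) (P : SimplePolygon) :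
    ∀ (N : ℕ) (Ls : List (List Pt)) (S : Finset (Sym2 Pt)),
      (Ls.map fun L => L.length + 1).sum ≤ N → Good P S Ls →
      (Ls.map fun L => HH x L.length).prod ≤ (cnt P S : ℝ) := by
  intro N
  have hx1 := (root_facts hx).1
  induction N with
  | zero =>
    intro Ls S hN hg
    cases Ls with
    | nil => simpa using cnt_pos S hg.diag hg.comp
    | cons L Ls => simp at hN
  | succ N ih =>
    intro Ls S hN hg
    cases Ls with
    | nil => simpa using cnt_pos S hg.diag hg.comp
    | cons L Ls =>
      simp only [List.map_cons, List.sum_cons] at hN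
      have hprod : 0 ≤ (Ls.map fun L => HH x L.length).prod := by
        apply List.prod_nonneg
        intro a ha
        obtain ⟨M, -, rfl⟩ := List.mem_map.1 ha
        exact (HH_pos (by linarith) _).le
      have hc := hg.ccw L List.mem_cons_self
      match L, hN, hg, hc with
      | [], hN, hg, hc =>
        rw [List.map_cons, List.prod_cons, HH_small (by simp), one_mul]
        refine ih Ls S (by simp at hN ⊢; omega) ?_
        exact ⟨hg.diag, hg.comp, fun M hM => hg.ccw M (List.mem_cons_of_mem _ hM),
          fun M hM => hg.sepd M (List.mem_cons_of_mem _ hM), (List.pairwise_cons.1 hg.pw).2⟩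
      | [_], hN, hg, hc =>
        rw [List.map_cons, List.prod_cons, HH_small (by simp), one_mul]
        refine ih Ls S (by simp at hN ⊢; omega) ?_
        exact ⟨hg.diag, hg.comp, fun M hM => hg.ccw M (List.mem_cons_of_mem _ hM),
          fun M hM => hg.sepd M (List.mem_cons_of_mem _ hM), (List.pairwise_cons.1 hg.pw).2⟩
      | [_, _], hN, hg, hc =>
        rw [List.map_cons, List.prod_cons, HH_small (by simp), one_mul]
        refine ih Ls S (by simp at hN ⊢; omega) ?_
        exact ⟨hg.diag, hg.comp, fun M hM => hg.ccw M (List.mem_cons_of_mem _ hM),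
          fun M hM => hg.sepd M (List.mem_cons_of_mem _ hM), (List.pairwise_cons.1 hg.pw).2⟩
      | [_, _, _], hN, hg, hc =>
        rw [List.map_cons, List.prod_cons, HH_small (by simp), one_mul]
        refine ih Ls S (by simp at hN ⊢; omega) ?_
        exact ⟨hg.diag, hg.comp, fun M hM => hg.ccw M (List.mem_cons_of_mem _ hM),
          fun M hM => hg.sepd M (List.mem_cons_of_mem _ hM), (List.pairwise_cons.1 hg.pw).2⟩
      | a :: b :: c :: d :: R, hN, hg, hc =>
        have hc' := hc
        simp only [CCW, List.triplewise_cons, List.pairwise_cons, List.mem_cons,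
          forall_eq_or_imp] at hc'
        obtain ⟨⟨⟨habc, habd, habR⟩, ⟨hacd, hacR⟩, hadR, haR⟩, ⟨⟨hbcd, hbcR⟩, hbdR, hbR⟩,
          ⟨hcdR, hcR⟩, hdR, hR⟩ := hc'
        have hsac : Sepd (a :: b :: c :: d :: R) a c :=
          ⟨by simp, by simp, ⟨d, by simp, hacd⟩, b, by simp, crs_neg_swap habc⟩
        have hsbd : Sepd (a :: b :: c :: d :: R) b d :=
          ⟨by simp, by simp, ⟨a, by simp, crs_pos_rot habd⟩, c, by simp, crs_neg_swap hbcd⟩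
        have hx1 : ¬ Compat s(a, c) s(b, d) := not_compat_cross habc habd hacd hbcd
        have g1 : Good P ({s(a, c)} ∪ S) ((a :: c :: d :: R) :: Ls) := by
          refine hg.step (by simp) ?_ ?_
          · intro e he
            rw [Finset.mem_singleton.1 he]
            refine ⟨a, c, rfl, hsac, ?_⟩
            simp only [List.mem_cons, forall_eq_or_imp]
            exact ⟨Or.inl trivial, Or.inr (Or.inl trivial), Or.inr (Or.inr hacd),
              fun r hr => Or.inr (Or.inr (hacR r hr))⟩
          · intro e he f hf
            rw [Finset.mem_singleton.1 he, Finset.mem_singleton.1 hf]; exact Or.inl rfl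
        have g2 : Good P ({s(b, d)} ∪ S) ((a :: b :: d :: R) :: Ls) := by
          refine hg.step (by simp) ?_ ?_
          · intro e he
            rw [Finset.mem_singleton.1 he]
            refine ⟨b, d, rfl, hsbd, ?_⟩
            simp only [List.mem_cons, forall_eq_or_imp]
            exact ⟨Or.inr (Or.inr (crs_pos_rot habd)), Or.inl trivial, Or.inr (Or.inl trivial),
              fun r hr => Or.inr (Or.inr (hbdR r hr))⟩
          · intro e he f hf
            rw [Finset.mem_singleton.1 he, Finset.mem_singleton.1 hf]; exact Or.inl rfl
        have i1 := ih _ _ (by simp at hN ⊢; omega) g1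
        have i2 := ih _ _ (by simp at hN ⊢; omega) g2
        simp only [List.map_cons, List.prod_cons, List.length_cons] at i1 i2 ⊢
        cases R with
        | nil =>
          have := cnt_add (P := P) (S := S) (S₁ := {s(a, c)} ∪ S) (S₂ := {s(b, d)} ∪ S)
            Finset.subset_union_right Finset.subset_union_right (e := s(a, c)) (f := s(b, d))
            (by simp) (by simp) hx1
          have this' : (cnt P ({s(a, c)} ∪ S) : ℝ) + cnt P ({s(b, d)} ∪ S) ≤ cnt P S := by
            exact_mod_cast this
          simp only [List.length_nil, zero_add, Nat.reduceAdd] at *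
          rw [HH_four]
          rw [HH_small le_rfl] at i1 i2
          linarith
        | cons e R =>
          simp only [List.pairwise_cons, List.mem_cons, forall_eq_or_imp] at *
          have hsbe : Sepd (a :: b :: c :: d :: e :: R) e b :=
            ⟨by simp, by simp, ⟨c, by simp, crs_pos_rot' hbcR.1⟩, a, by simp, by
              rw [crs_swap, crs_rot]; linarith [habR.1]⟩
          have hsbe' : Sepd (a :: b :: c :: d :: e :: R) b e :=
            ⟨by simp, by simp, ⟨a, by simp, crs_pos_rot habR.1⟩, c, by simp, crs_neg_swap hbcR.1⟩
          have hsce : Sepd (a :: b :: c :: d :: e :: R) c e :=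
            ⟨by simp, by simp, ⟨a, by simp, crs_pos_rot hacR.1⟩, d, by simp, crs_neg_swap hcdR.1⟩
          have g3 : Good P ({s(b, e), s(c, e)} ∪ S) ((a :: b :: e :: R) :: Ls) := by
            refine hg.step (by simp) ?_ ?_
            · intro f hf
              simp only [Finset.mem_insert, Finset.mem_singleton] at hf
              rcases hf with rfl | rfl
              · refine ⟨b, e, rfl, hsbe', ?_⟩
                simp only [List.mem_cons, forall_eq_or_imp]
                exact ⟨Or.inr (Or.inr (crs_pos_rot habR.1)), Or.inl trivial, Or.inr (Or.inl trivial),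
                  fun r hr => Or.inr (Or.inr (hbR.1 r hr))⟩
              · refine ⟨c, e, rfl, hsce, ?_⟩
                simp only [List.mem_cons, forall_eq_or_imp]
                exact ⟨Or.inr (Or.inr (crs_pos_rot hacR.1)), Or.inr (Or.inr (crs_pos_rot hbcR.1)),
                  Or.inr (Or.inl trivial), fun r hr => Or.inr (Or.inr (hcR.1 r hr))⟩
            · have hcomp : Compat s(b, e) s(c, e) := by
                rw [Sym2.eq_swap (a := b)]
                exact compat_of_side (crs_pos_rot' hbcR.1).le (crs_left _ _).ge
                  (fun h => absurd h (crs_pos_rot' hbcR.1).ne') fun _ => Or.inl rfl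
              intro f hf f' hf'
              simp only [Finset.mem_insert, Finset.mem_singleton] at hf hf'
              rcases hf with rfl | rfl <;> rcases hf' with rfl | rfl
              · exact Or.inl rfl
              · exact hcomp
              · exact hcomp.symm
              · exact Or.inl rfl
          have i3 := ih _ _ (by simp at hN ⊢; omega) g3
          simp only [List.map_cons, List.prod_cons, List.length_cons] at i1 i2 i3 ⊢
          have := cnt_add3 (P := P) (S := S) (S₁ := {s(a, c)} ∪ S) (S₂ := {s(b, d)} ∪ S)
            (S₃ := {s(b, e), s(c, e)} ∪ S)
            Finset.subset_union_right Finset.subset_union_right Finset.subset_union_right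
            (e := s(a, c)) (f := s(b, d)) (e' := s(a, c)) (g := s(b, e)) (f' := s(b, d))
            (g' := s(c, e))
            (by simp) (by simp) hx1 (by simp) (by simp)
            (not_compat_cross habc habR.1 hacR.1 hbcR.1)
            (by simp) (by simp) (not_compat_cross hbcd hbcR.1 hbdR.1 hcdR.1)
          have this' : (cnt P ({s(a, c)} ∪ S) : ℝ) + cnt P ({s(b, d)} ∪ S) +
              cnt P ({s(b, e), s(c, e)} ∪ S) ≤ cnt P S := by
            exact_mod_cast this
          have hrec := mul_le_mul_of_nonneg_right (HH_rec hx R.length) hprod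
          have e1 : R.length + 1 + 1 + 1 + 1 + 1 = R.length + 5 := by ring
          have e2 : R.length + 1 + 1 + 1 + 1 = R.length + 4 := by ring
          have e3 : R.length + 1 + 1 + 1 = R.length + 3 := by ring
          rw [e2] at i1 i2
          rw [e3] at i3
          rw [e1]
          linarith


/-! ### Index combinatorics -/

/-- the chord `i j` is a proper diagonal of the index polygon `I` -/
def Prp (I : Finset ℕ) (i j : ℕ) : Prop :=
  i ∈ I ∧ j ∈ I ∧ i < j ∧ (∃ k ∈ I, i < k ∧ k < j) ∧ ∃ k ∈ I, k < i ∨ j < k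

def UPrp (I : Finset ℕ) (i j : ℕ) : Prop := Prp I i j ∨ Prp I j i

def FS (Fr : ℕ → ℕ → Prop) (I : Finset ℕ) : Finset (ℕ × ℕ) :=
  (I ×ˢ I).filter fun e => Prp I e.1 e.2 ∧ Fr e.1 e.2

def TS (Dr Fr : ℕ → ℕ → Prop) (I : Finset ℕ) : Finset (ℕ × ℕ) :=
  (I ×ˢ I).filter fun e => e.1 < e.2 ∧ Dr e.1 e.2 ∧ ¬ Fr e.1 e.2 ∧
    ∃ c, UPrp I e.1 c ∧ Fr e.1 c ∧ UPrp I e.2 c ∧ Fr e.2 c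

lemma mem_FS {Fr : ℕ → ℕ → Prop} {I : Finset ℕ} {i j : ℕ} :
    (i, j) ∈ FS Fr I ↔ Prp I i j ∧ Fr i j := by
  unfold FS
  simp only [Finset.mem_filter, Finset.mem_product]
  constructor
  · exact fun h => h.2
  · exact fun h => ⟨⟨h.1.1, h.1.2.1⟩, h⟩

lemma mem_TS {Dr Fr : ℕ → ℕ → Prop} {I : Finset ℕ} {i j : ℕ} :
    (i, j) ∈ TS Dr Fr I ↔ i < j ∧ Dr i j ∧ ¬ Fr i j ∧
      ∃ c, UPrp I i c ∧ Fr i c ∧ UPrp I j c ∧ Fr j c := by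
  unfold TS
  simp only [Finset.mem_filter, Finset.mem_product]
  constructor
  · exact fun h => h.2
  · intro h
    obtain ⟨h1, h2, h3, c, h4, h5, h6, h7⟩ := h
    refine ⟨⟨?_, ?_⟩, h1, h2, h3, c, h4, h5, h6, h7⟩
    · rcases h4 with h | h; exacts [h.1, h.2.1]
    · rcases h6 with h | h; exacts [h.1, h.2.1]

def inI (I : Finset ℕ) (p q : ℕ) : Finset ℕ := I.filter fun k => p ≤ k ∧ k ≤ q
def outI (I : Finset ℕ) (p q : ℕ) : Finset ℕ := I.filter fun k => k ≤ p ∨ q ≤ k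

lemma Prp.mono {I J : Finset ℕ} (h : J ⊆ I) {i j : ℕ} (hp : Prp J i j) : Prp I i j := by
  obtain ⟨h1, h2, h3, ⟨k, h4, h5⟩, l, h6, h7⟩ := hp
  exact ⟨h h1, h h2, h3, ⟨k, h h4, h5⟩, l, h h6, h7⟩

lemma UPrp.mono {I J : Finset ℕ} (h : J ⊆ I) {i j : ℕ} (hp : UPrp J i j) : UPrp I i j :=
  hp.imp (Prp.mono h) (Prp.mono h)

lemma inI_sub (I : Finset ℕ) (p q : ℕ) : inI I p q ⊆ I := Finset.filter_subset _ _
lemma outI_sub (I : Finset ℕ) (p q : ℕ) : outI I p q ⊆ I := Finset.filter_subset _ _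
lemma mem_inI {I : Finset ℕ} {p q k : ℕ} : k ∈ inI I p q ↔ k ∈ I ∧ p ≤ k ∧ k ≤ q :=
  Finset.mem_filter
lemma mem_outI {I : Finset ℕ} {p q k : ℕ} : k ∈ outI I p q ↔ k ∈ I ∧ (k ≤ p ∨ q ≤ k) :=
  Finset.mem_filter

/-- A proper chord not interleaved with the proper chord `p q` lies on one side. -/
lemma prp_split {I : Finset ℕ} {p q i j : ℕ} (hpq : Prp I p q) (hij : Prp I i j)
    (hne : ¬ (i = p ∧ j = q)) (h1 : ¬ (i < p ∧ p < j ∧ j < q)) (h2 : ¬ (p < i ∧ i < q ∧ q < j)) :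
    Prp (inI I p q) i j ∨ Prp (outI I p q) i j := by
  obtain ⟨hp, hq, hlt, ⟨k, hk, hk1, hk2⟩, l, hl, hl1⟩ := hpq
  obtain ⟨hi, hj, hlt', ⟨k', hk', hk1', hk2'⟩, l', hl', hl1'⟩ := hij
  by_cases hin : p ≤ i ∧ j ≤ q
  · left
    refine ⟨mem_inI.2 ⟨hi, by omega⟩, mem_inI.2 ⟨hj, by omega⟩, hlt',
      ⟨k', mem_inI.2 ⟨hk', by omega⟩, hk1', hk2'⟩, ?_⟩
    by_cases hpi : p < i
    · exact ⟨p, mem_inI.2 ⟨hp, by omega⟩, Or.inl hpi⟩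
    · exact ⟨q, mem_inI.2 ⟨hq, by omega⟩, Or.inr (by omega)⟩
  · right
    refine ⟨mem_outI.2 ⟨hi, by omega⟩, mem_outI.2 ⟨hj, by omega⟩, hlt', ?_, ?_⟩
    · by_cases hbig : i ≤ p ∧ q ≤ j
      · by_cases hip : i < p
        · exact ⟨p, mem_outI.2 ⟨hp, by omega⟩, hip, by omega⟩
        · exact ⟨q, mem_outI.2 ⟨hq, by omega⟩, by omega, by omega⟩
      · exact ⟨k', mem_outI.2 ⟨hk', by omega⟩, hk1', hk2'⟩
    · by_cases hbig : i ≤ p ∧ q ≤ j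
      · exact ⟨l', mem_outI.2 ⟨hl', by omega⟩, hl1'⟩
      · by_cases hjp : j ≤ p
        · exact ⟨q, mem_outI.2 ⟨hq, by omega⟩, by omega⟩
        · exact ⟨p, mem_outI.2 ⟨hp, by omega⟩, by omega⟩

lemma card_split {I : Finset ℕ} {p q : ℕ} (hpq : Prp I p q) :
    (inI I p q).card + (outI I p q).card = I.card + 2 := by
  obtain ⟨hp, hq, hlt, -⟩ := hpq
  rw [← Finset.card_union_add_card_inter]
  congr 1
  · congr 1
    ext k
    rw [Finset.mem_union, mem_inI, mem_outI]
    constructor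
    · rintro (h | h) <;> exact h.1
    · intro h
      by_cases hk : p ≤ k ∧ k ≤ q
      · exact Or.inl ⟨h, hk⟩
      · exact Or.inr ⟨h, by omega⟩
  · have : inI I p q ∩ outI I p q = {p, q} := by
      ext k
      rw [Finset.mem_inter, mem_inI, mem_outI, Finset.mem_insert, Finset.mem_singleton]
      constructor
      · rintro ⟨⟨-, h1⟩, -, h2⟩; omega
      · rintro (rfl | rfl)
        · exact ⟨⟨hp, by omega⟩, hp, by omega⟩
        · exact ⟨⟨hq, by omega⟩, hq, by omega⟩
    rw [this, Finset.card_pair (by omega)]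

lemma card_in {I : Finset ℕ} {p q : ℕ} (hpq : Prp I p q) : 3 ≤ (inI I p q).card := by
  obtain ⟨hp, hq, hlt, ⟨k, hk, hk1, hk2⟩, -⟩ := hpq
  have : ({p, k, q} : Finset ℕ) ⊆ inI I p q := by
    intro m hm
    simp only [Finset.mem_insert, Finset.mem_singleton] at hm
    rcases hm with rfl | rfl | rfl
    · exact mem_inI.2 ⟨hp, by omega⟩
    · exact mem_inI.2 ⟨hk, by omega⟩
    · exact mem_inI.2 ⟨hq, by omega⟩
  have h3 : ({p, k, q} : Finset ℕ).card = 3 := Finset.card_eq_three.2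
    ⟨p, k, q, by omega, by omega, by omega, rfl⟩
  rw [← h3]; exact Finset.card_le_card this

lemma card_out {I : Finset ℕ} {p q : ℕ} (hpq : Prp I p q) : 3 ≤ (outI I p q).card := by
  obtain ⟨hp, hq, hlt, -, k, hk, hk1⟩ := hpq
  have : ({p, k, q} : Finset ℕ) ⊆ outI I p q := by
    intro m hm
    simp only [Finset.mem_insert, Finset.mem_singleton] at hm
    rcases hm with rfl | rfl | rfl
    · exact mem_outI.2 ⟨hp, by omega⟩
    · exact mem_outI.2 ⟨hk, by omega⟩
    · exact mem_outI.2 ⟨hq, by omega⟩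
  have h3 : ({p, k, q} : Finset ℕ).card = 3 := Finset.card_eq_three.2
    ⟨p, k, q, by omega, by omega, by omega, rfl⟩
  rw [← h3]; exact Finset.card_le_card this

lemma HH_succ {x : ℝ} (n : ℕ) (hn : 3 ≤ n) :
    HH x (n + 1) = 2 * HH x n * x ^ (if 4 ≤ n then 1 else 0) := by
  by_cases h : 4 ≤ n
  · obtain ⟨m, rfl⟩ := Nat.exists_eq_add_of_le h
    rw [if_pos h, show 4 + m + 1 = (m + 1) + 4 by ring, show 4 + m = m + 4 by ring, HH_add, HH_add]
    ring
  · obtain rfl : n = 3 := by omega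
    rw [HH_four, HH_small le_rfl]; simp

lemma HH_mono {x : ℝ} (hx : 1 ≤ x) : Monotone (HH x) := by
  apply monotone_nat_of_le_succ
  intro n
  by_cases hn : 3 ≤ n
  · rw [HH_succ n hn]
    have := HH_pos (by linarith : 0 < x) n
    have h1 : 1 ≤ x ^ (if 4 ≤ n then 1 else 0) := one_le_pow₀ hx
    nlinarith
  · rw [HH_small (by omega), HH_small (by omega)]

lemma one_le_HH {x : ℝ} (hx : 1 ≤ x) (n : ℕ) : 1 ≤ HH x n := by
  have := HH_mono hx (Nat.zero_le n)
  rwa [HH_small (by omega)] at this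

structure Sys (Dr Fr : ℕ → ℕ → Prop) : Prop where
  ds : ∀ i j, Dr i j → Dr j i
  fs : ∀ i j, Fr i j → Fr j i
  fd : ∀ i j, Fr i j → Dr i j
  ni : ∀ i j k l, i < j → j < k → k < l → Dr i k → Dr j l → False

lemma TS_empty {Dr Fr : ℕ → ℕ → Prop} (hs : Sys Dr Fr) {I : Finset ℕ} (h : FS Fr I = ∅) :
    TS Dr Fr I = ∅ := by
  rw [Finset.eq_empty_iff_forall_notMem] at h ⊢
  rintro ⟨i, j⟩ hij
  obtain ⟨-, -, -, c, h1, h2, -⟩ := mem_TS.1 hij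
  rcases h1 with h1 | h1
  · exact h _ (mem_FS.2 ⟨h1, h2⟩)
  · exact h _ (mem_FS.2 ⟨h1, hs.fs _ _ h2⟩)

lemma FS_card {Fr : ℕ → ℕ → Prop} {I : Finset ℕ} (h : (FS Fr I).Nonempty) : 4 ≤ I.card := by
  obtain ⟨⟨p, q⟩, hpq⟩ := h
  have hpq := (mem_FS.1 hpq).1
  have := card_in hpq
  have := card_out hpq
  have := card_split hpq
  omega

/-- split for unordered proper chords with `Dr` -/
lemma uprp_split {Dr Fr : ℕ → ℕ → Prop} (hs : Sys Dr Fr) {I : Finset ℕ} {p q i j : ℕ}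
    (hpq : Prp I p q) (hd : Dr p q) (hij : UPrp I i j) (hd' : Dr i j)
    (hne : ¬ (i = p ∧ j = q)) (hne' : ¬ (j = p ∧ i = q)) :
    UPrp (inI I p q) i j ∨ UPrp (outI I p q) i j := by
  have key : ∀ i j, Prp I i j → Dr i j → ¬ (i = p ∧ j = q) →
      Prp (inI I p q) i j ∨ Prp (outI I p q) i j := by
    intro i j hij hd' hne
    exact prp_split hpq hij hne (fun h => hs.ni i p j q h.1 h.2.1 h.2.2 hd' hd)
      (fun h => hs.ni p i q j h.1 h.2.1 h.2.2 hd hd')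
  rcases hij with h | h
  · exact (key i j h hd' hne).imp Or.inl Or.inl
  · exact (key j i h (hs.ds _ _ hd') hne').imp Or.inr Or.inr

lemma UPrp.mem {I : Finset ℕ} {i j : ℕ} (h : UPrp I i j) : i ∈ I ∧ j ∈ I ∧ i ≠ j := by
  rcases h with h | h
  · exact ⟨h.1, h.2.1, h.2.2.1.ne⟩
  · exact ⟨h.2.1, h.1, h.2.2.1.ne'⟩

lemma not_uprp_in {I : Finset ℕ} {p q : ℕ} (h : p ≤ q) :
    ¬ UPrp (inI I p q) p q ∧ ¬ UPrp (inI I p q) q p := by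
  have : ¬ Prp (inI I p q) p q := by
    rintro ⟨-, -, -, -, k, hk, hk'⟩
    have := mem_inI.1 hk
    omega
  have h2 : ¬ Prp (inI I p q) q p := by
    rintro ⟨-, -, hlt, -⟩; omega
  exact ⟨fun h => h.elim this h2, fun h => h.elim h2 this⟩

/-- mixed configuration is impossible -/
lemma mixed {Dr Fr : ℕ → ℕ → Prop} (hs : Sys Dr Fr) {I : Finset ℕ} {p q a b c : ℕ}
    (hlt : p < q) (hd : Dr p q) (h1 : UPrp (inI I p q) a c) (h2 : UPrp (outI I p q) b c)
    (hab : Dr a b) (hne : ¬ (b = p ∧ c = q)) (hne' : ¬ (b = q ∧ c = p)) : False := by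
  have n1 := not_uprp_in (I := I) hlt.le
  have hc1 := (mem_inI.1 h1.mem.2.1).2
  have ha := (mem_inI.1 h1.mem.1).2
  have hc2 := (mem_outI.1 h2.mem.2.1).2
  have hb := (mem_outI.1 h2.mem.1).2
  have hac := h1.mem.2.2
  have hbc := h2.mem.2.2
  have hap : ¬ (a = p ∧ c = q) := by rintro ⟨rfl, rfl⟩; exact n1.1 h1
  have haq : ¬ (a = q ∧ c = p) := by rintro ⟨rfl, rfl⟩; exact n1.2 h1
  have h3 : p < a ∧ a < q := by omega
  have h4 : b < p ∨ q < b := by omega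
  rcases h4 with h4 | h4
  · exact hs.ni b p a q h4 h3.1 h3.2 (hs.ds _ _ hab) hd
  · exact hs.ni p a q b h3.1 h3.2 h4 hd hab

/-- uniqueness of the extra triangle side -/
lemma extra_unique {Dr Fr : ℕ → ℕ → Prop} (hs : Sys Dr Fr) {I : Finset ℕ}
    (hall : ∀ i j, Prp I i j → Dr i j → Fr i j) {p q a b c a' b' c' : ℕ} (hlt : p < q)
    (hp : p ∈ I) (hq : q ∈ I) (hb : b ∈ I) (hb' : b' ∈ I)
    (hac : (a = p ∧ c = q) ∨ (a = q ∧ c = p)) (hac' : (a' = p ∧ c' = q) ∨ (a' = q ∧ c' = p))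
    (ho : b < p ∨ q < b) (ho' : b' < p ∨ q < b') (hab : Dr a b) (hab' : Dr a' b')
    (hn : ¬ Fr a b) (hn' : ¬ Fr a' b') (hbc : Fr b c) (hbc' : Fr b' c') : a = a' ∧ b = b' := by
  have key : ∀ i j k l, i ∈ I → j ∈ I → k ∈ I → l ∈ I → i < k → k < j → (l < i ∨ j < l) →
      Dr i j → Fr i j := fun i j k l hi hj hk hl h1 h2 h3 hd =>
    hall i j ⟨hi, hj, h1.trans h2, ⟨k, hk, h1, h2⟩, l, hl, h3⟩ hd
  have PP : ∀ b b', b ∈ I → b' ∈ I → Dr p b → ¬ Fr p b →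
      (b < p → ¬ (b < b' ∧ b' < p)) ∧ (q < b → ¬ b' < p ∧ ¬ b < b') := by
    intro b b' hb hb' hd hn
    refine ⟨fun h1 h2 => hn (hs.fs _ _ ?_), fun h1 => ⟨fun h2 => hn ?_, fun h2 => hn ?_⟩⟩
    · exact key b p b' q hb hp hb' hq h2.1 h2.2 (Or.inr hlt) (hs.ds _ _ hd)
    · exact key p b q b' hp hb hq hb' hlt h1 (Or.inl h2) hd
    · exact key p b q b' hp hb hq hb' hlt h1 (Or.inr h2) hd
  have QQ : ∀ b b', b ∈ I → b' ∈ I → Dr q b → ¬ Fr q b →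
      (q < b → ¬ (q < b' ∧ b' < b)) ∧ (b < p → ¬ b' < b ∧ ¬ q < b') := by
    intro b b' hb hb' hd hn
    refine ⟨fun h1 h2 => hn ?_, fun h1 => ⟨fun h2 => hn (hs.fs _ _ ?_), fun h2 => hn (hs.fs _ _ ?_)⟩⟩
    · exact key q b b' p hq hb hb' hp h2.1 h2.2 (Or.inl hlt) hd
    · exact key b q p b' hb hq hp hb' h1 hlt (Or.inl h2) (hs.ds _ _ hd)
    · exact key b q p b' hb hq hp hb' h1 hlt (Or.inr h2) (hs.ds _ _ hd)
  have PQ : ∀ b b', b ∈ I → b' ∈ I → (b < p ∨ q < b) → (b' < p ∨ q < b') → Dr p b → ¬ Fr p b →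
      Dr q b' → ¬ Fr q b' → Fr b q → Fr b' p → False := by
    intro b b' hb hb' ho ho' hd hn hd' hn' hf hf'
    obtain ⟨h1, h2⟩ := PP b b' hb hb' hd hn
    obtain ⟨h3, h4⟩ := QQ b' b hb' hb hd' hn'
    rcases lt_trichotomy b b' with h | rfl | h
    · have : b < p ∧ q < b' := by omega
      exact hs.ni b p q b' this.1 hlt this.2 (hs.fd _ _ hf) (hs.ds _ _ (hs.fd _ _ hf'))
    · exact hn' (hs.fs _ _ hf)
    · by_cases hbp : b < p
      · exact hs.ni b' b p q h hbp hlt (hs.fd _ _ hf') (hs.fd _ _ hf)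
      · have : q < b' := by omega
        exact hs.ni p q b' b hlt this h (hs.ds _ _ (hs.fd _ _ hf')) (hs.ds _ _ (hs.fd _ _ hf))
  rcases hac with ⟨rfl, rfl⟩ | ⟨rfl, rfl⟩ <;> rcases hac' with ⟨rfl, rfl⟩ | ⟨rfl, rfl⟩
  · have := PP b b' hb hb' hab hn
    have := PP b' b hb' hb hab' hn'
    omega
  · exact (PQ b b' hb hb' ho ho' hab hn hab' hn' hbc hbc').elim
  · exact (PQ b' b hb' hb ho' ho hab' hn' hab hn hbc' hbc).elim
  · have := QQ b b' hb hb' hab hn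
    have := QQ b' b hb' hb hab' hn'
    omega

lemma lemC {x : ℝ} (hx : 1 ≤ x) {Dr Fr : ℕ → ℕ → Prop} (hs : Sys Dr Fr) :
    ∀ (N : ℕ) (I : Finset ℕ), I.card ≤ N → (∀ i j, Prp I i j → Dr i j → Fr i j) →
      2 ^ (FS Fr I).card * x ^ (TS Dr Fr I).card ≤ HH x I.card := by
  intro N
  induction N with
  | zero =>
    intro I hI hall
    have h1 : FS Fr I = ∅ := by
      by_contra h
      have := FS_card (Finset.nonempty_iff_ne_empty.2 h)
      omega
    rw [TS_empty hs h1, h1]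
    simpa using one_le_HH hx _
  | succ N ih =>
    intro I hI hall
    by_cases h1 : FS Fr I = ∅
    · rw [TS_empty hs h1, h1]
      simpa using one_le_HH hx _
    obtain ⟨⟨p, q⟩, hpqF, hmin⟩ := (FS Fr I).exists_min_image (fun e => (inI I e.1 e.2).card)
      (Finset.nonempty_iff_ne_empty.2 h1)
    obtain ⟨hpq, hF⟩ := mem_FS.1 hpqF
    have hD := hs.fd _ _ hF
    have hlt := hpq.2.2.1
    have hc1 := card_in hpq
    have hc2 := card_out hpq
    have hc := card_split hpq
    -- no `Fr` chord on the inner side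
    have hF1 : ∀ i j, UPrp (inI I p q) i j → ¬ Fr i j := by
      have aux : ∀ i j, Prp (inI I p q) i j → ¬ Fr i j := by
        intro i j hij hf
        have := hmin (i, j) (mem_FS.2 ⟨hij.mono (inI_sub _ _ _), hf⟩)
        have hss : inI I i j ⊂ inI I p q := by
          have hi := mem_inI.1 hij.1
          have hj := mem_inI.1 hij.2.1
          obtain ⟨k, hk, hk'⟩ := hij.2.2.2.2
          refine Finset.ssubset_iff_subset_ne.2 ⟨fun m hm => ?_, fun h => ?_⟩
          · have := mem_inI.1 hm
            exact mem_inI.2 ⟨this.1, by omega⟩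
          · rw [← h] at hk
            have := mem_inI.1 hk
            omega
        have := Finset.card_lt_card hss
        simp only at *
        omega
      intro i j hij hf
      rcases hij with h | h
      · exact aux _ _ h hf
      · exact aux _ _ h (hs.fs _ _ hf)
    have hsplit : ∀ i j, UPrp I i j → Fr i j → ¬ (i = p ∧ j = q) → ¬ (j = p ∧ i = q) →
        UPrp (outI I p q) i j := by
      intro i j hij hf hn1 hn2
      exact (uprp_split hs hpq hD hij (hs.fd _ _ hf) hn1 hn2).resolve_left fun h => hF1 i j h hf
    have hFsub : FS Fr I ⊆ insert (p, q) (FS Fr (outI I p q)) := by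
      rintro ⟨i, j⟩ hij
      obtain ⟨h2, h3⟩ := mem_FS.1 hij
      by_cases hn : i = p ∧ j = q
      · rw [hn.1, hn.2]; exact Finset.mem_insert_self _ _
      · have := hsplit i j (Or.inl h2) h3 hn (by have := h2.2.2.1; omega)
        refine Finset.mem_insert_of_mem (mem_FS.2 ⟨this.resolve_right fun h => ?_, h3⟩)
        have := h2.2.2.1
        have := h.2.2.1
        omega
    have hFc : (FS Fr I).card ≤ (FS Fr (outI I p q)).card + 1 :=
      (Finset.card_le_card hFsub).trans (Finset.card_insert_le _ _)
    -- extra elements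
    have hX : ∀ e ∈ TS Dr Fr I \ TS Dr Fr (outI I p q), ∃ a b c, ((e.1 = a ∧ e.2 = b) ∨
        (e.1 = b ∧ e.2 = a)) ∧ ((a = p ∧ c = q) ∨ (a = q ∧ c = p)) ∧
        UPrp (outI I p q) b c ∧ Fr b c ∧ Dr a b ∧ ¬ Fr a b ∧ (b < p ∨ q < b) := by
      rintro ⟨u, v⟩ he
      obtain ⟨he1, he2⟩ := Finset.mem_sdiff.1 he
      obtain ⟨huv, hd, hn, c, h4, h5, h6, h7⟩ := mem_TS.1 he1
      have out : ∀ b a c, UPrp (outI I p q) b c → ((a = p ∧ c = q) ∨ (a = q ∧ c = p)) →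
          a ≠ b → (b < p ∨ q < b) := by
        intro b a c h h' h''
        have := (mem_outI.1 h.mem.1).2
        have := h.mem.2.2
        omega
      by_cases hu : (u = p ∧ c = q) ∨ (u = q ∧ c = p)
      · have hv := hsplit v c h6 h7 (by omega) (by omega)
        exact ⟨u, v, c, Or.inl ⟨rfl, rfl⟩, hu, hv, h7, hd, hn, out v u c hv hu huv.ne⟩
      · have hu' := hsplit u c h4 h5 (by omega) (by omega)
        by_cases hv : (v = p ∧ c = q) ∨ (v = q ∧ c = p)
        · exact ⟨v, u, c, Or.inr ⟨rfl, rfl⟩, hv, hu', h5, hs.ds _ _ hd, fun h => hn (hs.fs _ _ h),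
            out u v c hu' hv huv.ne'⟩
        · have hv' := hsplit v c h6 h7 (by omega) (by omega)
          exact (he2 (mem_TS.2 ⟨huv, hd, hn, c, hu', h5, hv', h7⟩)).elim
    have hXlt : ∀ e ∈ TS Dr Fr I \ TS Dr Fr (outI I p q), e.1 < e.2 := by
      rintro ⟨u, v⟩ he
      exact (mem_TS.1 (Finset.mem_sdiff.1 he).1).1
    have hXc : (TS Dr Fr I \ TS Dr Fr (outI I p q)).card ≤
        if 4 ≤ (outI I p q).card then 1 else 0 := by
      by_cases h4 : 4 ≤ (outI I p q).card
      · rw [if_pos h4, Finset.card_le_one]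
        intro e he e' he'
        obtain ⟨a, b, c, g1, g2, g3, g4, g5, g6, g7⟩ := hX e he
        obtain ⟨a', b', c', g1', g2', g3', g4', g5', g6', g7'⟩ := hX e' he'
        have hl := hXlt e he
        have hl' := hXlt e' he'
        have := extra_unique hs hall hlt hpq.1 hpq.2.1 (outI_sub _ _ _ g3.mem.1)
          (outI_sub _ _ _ g3'.mem.1) g2 g2' g7 g7' g5 g5' g6 g6' g4 g4'
        ext <;> omega
      · rw [if_neg h4, Nat.le_zero, Finset.card_eq_zero, Finset.eq_empty_iff_forall_notMem]
        intro e he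
        obtain ⟨a, b, c, g1, g2, g3, g4, g5, g6, g7⟩ := hX e he
        apply h4
        rcases g3 with g3 | g3
        · exact FS_card ⟨_, mem_FS.2 ⟨g3, g4⟩⟩
        · exact FS_card ⟨_, mem_FS.2 ⟨g3, hs.fs _ _ g4⟩⟩
    have hTc : (TS Dr Fr I).card ≤ (TS Dr Fr (outI I p q)).card +
        if 4 ≤ (outI I p q).card then 1 else 0 := by
      have h5 : TS Dr Fr I ⊆ TS Dr Fr (outI I p q) ∪ (TS Dr Fr I \ TS Dr Fr (outI I p q)) := by
        rw [Finset.union_sdiff_self_eq_union]; exact Finset.subset_union_right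
      have := (Finset.card_le_card h5).trans (Finset.card_union_le _ _)
      omega
    have hi := ih (outI I p q) (by omega)
      (fun i j h => hall i j (h.mono (outI_sub _ _ _)))
    calc 2 ^ (FS Fr I).card * x ^ (TS Dr Fr I).card
        ≤ 2 ^ ((FS Fr (outI I p q)).card + 1) * x ^ ((TS Dr Fr (outI I p q)).card +
          if 4 ≤ (outI I p q).card then 1 else 0) := by
          gcongr
          · norm_num
      _ = 2 * (2 ^ (FS Fr (outI I p q)).card * x ^ (TS Dr Fr (outI I p q)).card) *
          x ^ (if 4 ≤ (outI I p q).card then 1 else 0) := by rw [pow_add, pow_add]; ring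
      _ ≤ 2 * HH x (outI I p q).card * x ^ (if 4 ≤ (outI I p q).card then 1 else 0) := by gcongr
      _ = HH x ((outI I p q).card + 1) := (HH_succ _ hc2).symm
      _ ≤ HH x I.card := HH_mono hx (by omega)

def Sided (J : Finset ℕ) (i j : ℕ) : Prop :=
  (∀ k ∈ J, i ≤ k ∧ k ≤ j) ∨ ∀ k ∈ J, k ≤ i ∨ j ≤ k

def RSep (J J' : Finset ℕ) : Prop :=
  ∃ p q, p < q ∧ (∀ k ∈ J, p ≤ k ∧ k ≤ q) ∧ ∀ k ∈ J', k ≤ p ∨ q ≤ k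

lemma lemPoly {x : ℝ} (hx : 1 ≤ x) {Dr Fr : ℕ → ℕ → Prop} (hs : Sys Dr Fr) :
    ∀ (N : ℕ) (I : Finset ℕ), I.card ≤ N → ∃ Js : List (Finset ℕ),
      (∀ J ∈ Js, J ⊆ I ∧ (FS Fr J).Nonempty ∧
        ∀ i ∈ I, ∀ j ∈ I, i < j → Dr i j → ¬ Fr i j → Sided J i j) ∧
      Js.Pairwise RSep ∧
      2 ^ (FS Fr I).card * x ^ (TS Dr Fr I).card ≤ (Js.map fun J => HH x J.card).prod := by
  intro N
  induction N with
  | zero =>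
    intro I hI
    have h1 : FS Fr I = ∅ := by
      by_contra h
      have := FS_card (Finset.nonempty_iff_ne_empty.2 h)
      omega
    refine ⟨[], by simp, by simp, ?_⟩
    rw [TS_empty hs h1, h1]
    simp
  | succ N ih =>
    intro I hI
    by_cases h1 : FS Fr I = ∅
    · refine ⟨[], by simp, by simp, ?_⟩
      rw [TS_empty hs h1, h1]
      simp
    by_cases hex : ∃ p q, Prp I p q ∧ Dr p q ∧ ¬ Fr p q
    swap
    · push Not at hex
      refine ⟨[I], ?_, by simp, ?_⟩
      · intro J hJ
        rw [List.mem_singleton] at hJ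
        subst hJ
        refine ⟨Finset.Subset.refl _, Finset.nonempty_iff_ne_empty.2 h1, ?_⟩
        intro i hi j hj hij hd hn
        by_contra hsd
        simp only [Sided, not_or, not_forall] at hsd
        obtain ⟨⟨k, hk, hk'⟩, l, hl, hl'⟩ := hsd
        exact hn (hex i j ⟨hi, hj, hij, ⟨l, hl, by omega⟩, k, hk, by omega⟩ hd)
      · simpa using lemC hx hs I.card I le_rfl hex
    obtain ⟨p, q, hpq, hD, hF⟩ := hex
    have hlt := hpq.2.2.1
    have hc1 := card_in hpq
    have hc2 := card_out hpq
    have hc := card_split hpq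
    obtain ⟨A, hA1, hA2, hA3⟩ := ih (inI I p q) (by omega)
    obtain ⟨B, hB1, hB2, hB3⟩ := ih (outI I p q) (by omega)
    have hsplit : ∀ i j, UPrp I i j → Fr i j →
        UPrp (inI I p q) i j ∨ UPrp (outI I p q) i j := by
      intro i j hij hf
      refine uprp_split hs hpq hD hij (hs.fd _ _ hf) ?_ ?_
      · rintro ⟨rfl, rfl⟩; exact hF hf
      · rintro ⟨rfl, rfl⟩; exact hF (hs.fs _ _ hf)
    have hFsub : FS Fr I ⊆ FS Fr (inI I p q) ∪ FS Fr (outI I p q) := by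
      rintro ⟨i, j⟩ hij
      obtain ⟨h2, h3⟩ := mem_FS.1 hij
      have hor : ∀ K, UPrp K i j → Prp K i j := fun K h => h.resolve_right fun h' => by
        have := h2.2.2.1
        have := h'.2.2.1
        omega
      rcases hsplit i j (Or.inl h2) h3 with h | h
      · exact Finset.mem_union_left _ (mem_FS.2 ⟨hor _ h, h3⟩)
      · exact Finset.mem_union_right _ (mem_FS.2 ⟨hor _ h, h3⟩)
    have hTsub : TS Dr Fr I ⊆ TS Dr Fr (inI I p q) ∪ TS Dr Fr (outI I p q) := by
      rintro ⟨u, v⟩ he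
      obtain ⟨huv, hd, hn, c, h4, h5, h6, h7⟩ := mem_TS.1 he
      have nd : ∀ b, Fr b c → ¬ (b = p ∧ c = q) ∧ ¬ (b = q ∧ c = p) := by
        intro b hb
        constructor
        · rintro ⟨rfl, rfl⟩; exact hF hb
        · rintro ⟨rfl, rfl⟩; exact hF (hs.fs _ _ hb)
      rcases hsplit u c h4 h5 with h | h <;> rcases hsplit v c h6 h7 with h' | h'
      · exact Finset.mem_union_left _ (mem_TS.2 ⟨huv, hd, hn, c, h, h5, h', h7⟩)
      · exact (mixed hs hlt hD h h' hd (nd v h7).1 (nd v h7).2).elim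
      · exact (mixed hs hlt hD h' h (hs.ds _ _ hd) (nd u h5).1 (nd u h5).2).elim
      · exact Finset.mem_union_right _ (mem_TS.2 ⟨huv, hd, hn, c, h, h5, h', h7⟩)
    have hFc := (Finset.card_le_card hFsub).trans (Finset.card_union_le _ _)
    have hTc := (Finset.card_le_card hTsub).trans (Finset.card_union_le _ _)
    refine ⟨A ++ B, ?_, ?_, ?_⟩
    · intro J hJ
      rcases List.mem_append.1 hJ with hJ | hJ
      · obtain ⟨g1, g2, g3⟩ := hA1 J hJ
        refine ⟨g1.trans (inI_sub _ _ _), g2, ?_⟩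
        intro i hi j hj hij hd hn
        by_cases hin : p ≤ i ∧ j ≤ q
        · exact g3 i (mem_inI.2 ⟨hi, by omega⟩) j (mem_inI.2 ⟨hj, by omega⟩) hij hd hn
        · have n1 : ¬ (i < p ∧ p < j ∧ j < q) := fun h => hs.ni i p j q h.1 h.2.1 h.2.2 hd hD
          have n2 : ¬ (p < i ∧ i < q ∧ q < j) := fun h => hs.ni p i q j h.1 h.2.1 h.2.2 hD hd
          by_cases hbig : i ≤ p ∧ q ≤ j
          · left; intro k hk; have := (mem_inI.1 (g1 hk)).2; omega
          · right; intro k hk; have := (mem_inI.1 (g1 hk)).2; omega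
      · obtain ⟨g1, g2, g3⟩ := hB1 J hJ
        refine ⟨g1.trans (outI_sub _ _ _), g2, ?_⟩
        intro i hi j hj hij hd hn
        have n1 : ¬ (i < p ∧ p < j ∧ j < q) := fun h => hs.ni i p j q h.1 h.2.1 h.2.2 hd hD
        have n2 : ¬ (p < i ∧ i < q ∧ q < j) := fun h => hs.ni p i q j h.1 h.2.1 h.2.2 hD hd
        by_cases hin : p ≤ i ∧ j ≤ q
        · right; intro k hk; have := (mem_outI.1 (g1 hk)).2; omega
        · exact g3 i (mem_outI.2 ⟨hi, by omega⟩) j (mem_outI.2 ⟨hj, by omega⟩) hij hd hn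
    · rw [List.pairwise_append]
      refine ⟨hA2, hB2, fun J hJ J' hJ' => ⟨p, q, hlt, fun k hk => ?_, fun k hk => ?_⟩⟩
      · exact (mem_inI.1 ((hA1 J hJ).1 hk)).2
      · exact (mem_outI.1 ((hB1 J' hJ').1 hk)).2
    · rw [List.map_append, List.prod_append]
      calc 2 ^ (FS Fr I).card * x ^ (TS Dr Fr I).card
          ≤ 2 ^ ((FS Fr (inI I p q)).card + (FS Fr (outI I p q)).card) *
            x ^ ((TS Dr Fr (inI I p q)).card + (TS Dr Fr (outI I p q)).card) := by
            gcongr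
            · norm_num
        _ = (2 ^ (FS Fr (inI I p q)).card * x ^ (TS Dr Fr (inI I p q)).card) *
            (2 ^ (FS Fr (outI I p q)).card * x ^ (TS Dr Fr (outI I p q)).card) := by
            rw [pow_add, pow_add]; ring
        _ ≤ _ := by
            have : 0 ≤ (2:ℝ) ^ (FS Fr (inI I p q)).card * x ^ (TS Dr Fr (inI I p q)).card := by
              positivity
            exact mul_le_mul hA3 hB3 (by positivity) (this.trans hA3)


/-! ### Cyclic ordering of a convex point set -/

lemma exists_sorted (r : Pt → Pt → Prop) (s : Finset Pt)
    (ht : ∀ a ∈ s, ∀ b ∈ s, ∀ c ∈ s, r a b → r b c → r a c)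
    (htot : ∀ a ∈ s, ∀ b ∈ s, a ≠ b → r a b ∨ r b a) :
    ∃ L : List Pt, (∀ p, p ∈ L ↔ p ∈ s) ∧ L.Pairwise r := by
  have hmin : ∀ t : Finset Pt, t ⊆ s → t.Nonempty → ∃ m ∈ t, ∀ b ∈ t, b ≠ m → r m b := by
    intro t
    induction t using Finset.induction_on with
    | empty => intro _ h; exact absurd h (by simp)
    | insert a t ha ih =>
      intro hsub _
      rcases t.eq_empty_or_nonempty with rfl | hne
      · exact ⟨a, by simp, by simp⟩
      · obtain ⟨m, hm, hmm⟩ := ih ((Finset.subset_insert _ _).trans hsub) hne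
        have hms := hsub (Finset.mem_insert_of_mem hm)
        have has := hsub (Finset.mem_insert_self a t)
        have ham : a ≠ m := fun h => ha (h ▸ hm)
        rcases htot a has m hms ham with h | h
        · refine ⟨a, Finset.mem_insert_self _ _, fun b hb hba => ?_⟩
          have hb' := (Finset.mem_insert.1 hb).resolve_left hba
          by_cases hbm : b = m
          · rwa [hbm]
          · exact ht a has m hms b (hsub hb) h (hmm b hb' hbm)
        · refine ⟨m, Finset.mem_insert_of_mem hm, fun b hb hbm => ?_⟩
          rcases Finset.mem_insert.1 hb with rfl | hb'
          · exact h
          · exact hmm b hb' hbm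
  have key : ∀ N, ∀ t : Finset Pt, t.card = N → t ⊆ s →
      ∃ L : List Pt, (∀ p, p ∈ L ↔ p ∈ t) ∧ L.Pairwise r := by
    intro N
    induction N with
    | zero =>
      intro t ht _
      rw [Finset.card_eq_zero] at ht
      subst ht
      exact ⟨[], by simp, List.Pairwise.nil⟩
    | succ N ih =>
      intro t htc hts
      obtain ⟨m, hm, hmm⟩ := hmin t hts (Finset.card_pos.1 (by omega))
      obtain ⟨L, hL1, hL2⟩ := ih (t.erase m) (by rw [Finset.card_erase_of_mem hm]; omega)
        ((Finset.erase_subset _ _).trans hts)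
      refine ⟨m :: L, fun p => ?_, List.pairwise_cons.2 ⟨fun b hb => ?_, hL2⟩⟩
      · rw [List.mem_cons, hL1, Finset.mem_erase]
        constructor
        · rintro (rfl | h)
          · exact hm
          · exact h.2
        · intro h
          by_cases hp : p = m
          · exact Or.inl hp
          · exact Or.inr ⟨hp, h⟩
      · have := Finset.mem_erase.1 ((hL1 b).1 hb)
        exact hmm b this.2 this.1
  exact key s.card s rfl (Finset.Subset.refl _)

def lexlt (v p : Pt) : Prop := v.1 < p.1 ∨ (v.1 = p.1 ∧ v.2 < p.2)

lemma crs_trans {v a b c : Pt} (ha : lexlt v a) (hb : lexlt v b) (hc : lexlt v c)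
    (h1 : 0 < crs v a b) (h2 : 0 < crs v b c) : 0 < crs v a c := by
  have ident : crs v a c * (b.1 - v.1) = crs v a b * (c.1 - v.1) + crs v b c * (a.1 - v.1) := by
    unfold crs; ring
  have hb' : v.1 < b.1 := by
    rcases hb with h | ⟨h, h'⟩
    · exact h
    · exfalso
      have : crs v b c = - ((b.2 - v.2) * (c.1 - v.1)) := by unfold crs; rw [h]; ring
      rw [this] at h2
      have hc1 : v.1 ≤ c.1 := by rcases hc with h | h; exacts [h.le, h.1.le]
      have := mul_nonneg (by linarith : 0 ≤ b.2 - v.2) (by linarith : 0 ≤ c.1 - v.1)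
      linarith
  have hpos : 0 < crs v a c * (b.1 - v.1) := by
    rw [ident]
    rcases hc with h | ⟨h, h'⟩
    · have hc1 : v.1 ≤ a.1 := by rcases ha with h | h; exacts [h.le, h.1.le]
      have := mul_pos h1 (by linarith : 0 < c.1 - v.1)
      have := mul_nonneg h2.le (by linarith : 0 ≤ a.1 - v.1)
      linarith
    · rcases ha with g | ⟨g, g'⟩
      · have := mul_pos h2 (by linarith : 0 < a.1 - v.1)
        rw [← h, sub_self, mul_zero, zero_add]; exact this
      · exfalso
        have : crs v a b = - ((a.2 - v.2) * (b.1 - v.1)) := by unfold crs; rw [g]; ring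
        have := mul_pos (by linarith : 0 < a.2 - v.2) (by linarith : 0 < b.1 - v.1)
        linarith
  exact pos_of_mul_pos_left hpos (by linarith)

lemma exists_ccw (P : SimplePolygon) {Q : Finset Pt} (hQ : ∀ p ∈ Q, P.IsVtx p)
    (hne : Q.Nonempty) (hconv : InConvexPosition Q) :
    ∃ L : List Pt, (∀ p, p ∈ L ↔ p ∈ Q) ∧ CCW L := by
  obtain ⟨v, hv, hmin⟩ := Q.exists_min_image (fun p => toLex p) hne
  have hlex : ∀ p ∈ Q.erase v, lexlt v p := by
    intro p hp
    obtain ⟨hpv, hp⟩ := Finset.mem_erase.1 hp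
    have h := hmin p hp
    rw [Prod.Lex.toLex_le_toLex] at h
    rcases h with h | ⟨h, h'⟩
    · exact Or.inl h
    · exact Or.inr ⟨h, lt_of_le_of_ne h' fun h2 => hpv (Prod.ext h.symm h2.symm)⟩
  have hgp : ∀ a ∈ Q, ∀ b ∈ Q, ∀ c ∈ Q, a ≠ b → a ≠ c → b ≠ c → crs a b c ≠ 0 :=
    fun a ha b hb c hc => P.gp (hQ a ha) (hQ b hb) (hQ c hc)
  obtain ⟨L, hL1, hL2⟩ := exists_sorted (fun a b => 0 < crs v a b) (Q.erase v)
    (fun a ha b hb c hc h1 h2 => crs_trans (hlex a ha) (hlex b hb) (hlex c hc) h1 h2)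
    (fun a ha b hb hab => by
      obtain ⟨ha1, ha2⟩ := Finset.mem_erase.1 ha
      obtain ⟨hb1, hb2⟩ := Finset.mem_erase.1 hb
      rcases lt_or_gt_of_ne (hgp v hv a ha2 b hb2 ha1.symm hb1.symm hab) with h | h
      · right; rw [crs_swap']; linarith
      · left; exact h)
  refine ⟨v :: L, fun p => ?_, ?_⟩
  · rw [List.mem_cons, hL1, Finset.mem_erase]
    constructor
    · rintro (rfl | h)
      · exact hv
      · exact h.2
    · intro h
      by_cases hp : p = v
      · exact Or.inl hp
      · exact Or.inr ⟨hp, h⟩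
  · unfold CCW
    rw [List.triplewise_cons]
    refine ⟨hL2, ?_⟩
    have hmem : ∀ p ∈ L, p ∈ Q.erase v := fun p hp => (hL1 p).1 hp
    rw [List.triplewise_iff_getElem]
    intro i j k hij hjk hk
    have hpw := List.pairwise_iff_getElem.1 hL2
    have h1 := hpw i j (by omega) (by omega) hij
    have h2 := hpw j k (by omega) (by omega) hjk
    have h3 := hpw i k (by omega) (by omega) (by omega)
    obtain ⟨a1, a2⟩ := Finset.mem_erase.1 (hmem L[i] (List.getElem_mem _))
    obtain ⟨b1, b2⟩ := Finset.mem_erase.1 (hmem L[j] (List.getElem_mem _))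
    obtain ⟨c1, c2⟩ := Finset.mem_erase.1 (hmem L[k] (List.getElem_mem _))
    generalize L[i] = a at *
    generalize L[j] = b at *
    generalize L[k] = c at *
    have hab := (ne_of_crs h1).2.2
    have hbc := (ne_of_crs h2).2.2
    have hac := (ne_of_crs h3).2.2
    rcases lt_or_gt_of_ne (hgp a a2 b b2 c c2 hab hac hbc) with h | h
    · exfalso
      have hi := tri_interior (a := v) (b := a) (c := c) (y := b) h3 h1
        (by rw [crs_swap']; linarith) (by rw [crs_rot']; exact h2)
      have hi := interior_subset hi
      refine hconv b b2 (convexHull_mono ?_ hi)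
      intro p hp
      simp only [Set.mem_insert_iff, Set.mem_singleton_iff] at hp
      rw [Finset.mem_coe, Finset.mem_erase]
      rcases hp with rfl | rfl | rfl
      · exact ⟨b1.symm, hv⟩
      · exact ⟨hab, a2⟩
      · exact ⟨hbc.symm, c2⟩
    · exact h

structure Enum (Q : Finset Pt) (n : ℕ) (v : ℕ → Pt) : Prop where
  pos : ∀ i j k, i < j → j < k → k < n → 0 < crs (v i) (v j) (v k)
  mem : ∀ i, i < n → v i ∈ Q
  surj : ∀ p ∈ Q, ∃ i, i < n ∧ v i = p
  three : 3 ≤ n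

lemma exists_enum (P : SimplePolygon) {Q : Finset Pt} (hQ : ∀ p ∈ Q, P.IsVtx p)
    (h3 : 3 ≤ Q.card) (hconv : InConvexPosition Q) : ∃ n v, Enum Q n v := by
  obtain ⟨L, hL1, hL2⟩ := exists_ccw P hQ (Finset.card_pos.1 (by omega)) hconv
  have hget : ∀ i (h : i < L.length), L.getD i (0, 0) = L[i] := fun i h => by
    simp [h]
  refine ⟨L.length, fun i => L.getD i (0, 0), ?_, ?_, ?_, ?_⟩
  · intro i j k hij hjk hk
    rw [hget i (by omega), hget j (by omega), hget k hk]
    exact List.triplewise_iff_getElem.1 hL2 i j k hij hjk hk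
  · intro i hi
    rw [hget i hi]
    exact (hL1 _).1 (List.getElem_mem _)
  · intro p hp
    obtain ⟨i, hi, rfl⟩ := List.getElem_of_mem ((hL1 p).2 hp)
    exact ⟨i, hi, hget i hi⟩
  · have : Q = L.toFinset := by ext p; rw [List.mem_toFinset, hL1]
    rw [this] at h3
    exact h3.trans (List.toFinset_card_le L)

namespace Enum
variable {Q : Finset Pt} {n : ℕ} {v : ℕ → Pt}

lemma out (h : Enum Q n v) {i j k : ℕ} (hij : i < j) (hj : j < n) (hk : k < n)
    (ho : k < i ∨ j < k) : 0 < crs (v i) (v j) (v k) := by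
  rcases ho with ho | ho
  · exact crs_pos_rot (h.pos k i j ho hij hj)
  · exact h.pos i j k hij ho hk

lemma btw (h : Enum Q n v) {i j k : ℕ} (hik : i < k) (hkj : k < j) (hj : j < n) :
    crs (v i) (v j) (v k) < 0 := crs_neg_swap (h.pos i k j hik hkj hj)

lemma ne (h : Enum Q n v) {i j : ℕ} (hij : i < j) (hj : j < n) : v i ≠ v j := by
  have h3 := h.three
  by_cases h1 : 0 < i
  · exact (ne_of_crs (h.pos 0 i j h1 hij hj)).2.2
  by_cases h2 : i + 1 < j
  · exact (ne_of_crs (h.pos i (i + 1) j (by omega) h2 hj)).2.1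
  · exact (ne_of_crs (h.pos i j (j + 1) hij (by omega) (by omega))).1

lemma inj (h : Enum Q n v) {i j : ℕ} (hi : i < n) (hj : j < n) (hij : v i = v j) : i = j := by
  rcases lt_trichotomy i j with h' | h' | h'
  · exact absurd hij (h.ne h' hj)
  · exact h'
  · exact absurd hij.symm (h.ne h' hi)

/-- weak side statements -/
lemma side_out (h : Enum Q n v) {i j k : ℕ} (hij : i < j) (hj : j < n) (hk : k < n)
    (ho : k ≤ i ∨ j ≤ k) : 0 ≤ crs (v i) (v j) (v k) ∧
      (crs (v i) (v j) (v k) = 0 → v k = v i ∨ v k = v j) := by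
  by_cases h1 : k = i
  · subst h1; exact ⟨(crs_left _ _).ge, fun _ => Or.inl rfl⟩
  by_cases h2 : k = j
  · subst h2; exact ⟨(crs_right _ _).ge, fun _ => Or.inr rfl⟩
  have := h.out hij hj hk (by omega)
  exact ⟨this.le, fun h0 => absurd h0 this.ne'⟩

lemma side_in (h : Enum Q n v) {i j k : ℕ} (hij : i < j) (hj : j < n)
    (hik : i ≤ k) (hkj : k ≤ j) : 0 ≤ crs (v j) (v i) (v k) ∧
      (crs (v j) (v i) (v k) = 0 → v k = v j ∨ v k = v i) := by
  by_cases h1 : k = i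
  · subst h1; exact ⟨(crs_right _ _).ge, fun _ => Or.inr rfl⟩
  by_cases h2 : k = j
  · subst h2; exact ⟨(crs_left _ _).ge, fun _ => Or.inl rfl⟩
  have := h.btw (i := i) (j := j) (k := k) (by omega) (by omega) hj
  rw [crs_swap]
  exact ⟨by linarith, fun h0 => by linarith⟩

lemma compat_out (h : Enum Q n v) {i j k l : ℕ} (hij : i < j) (hj : j < n) (hk : k < n)
    (hl : l < n) (h1 : k ≤ i ∨ j ≤ k) (h2 : l ≤ i ∨ j ≤ l) :
    Compat s(v i, v j) s(v k, v l) :=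
  compat_of_side (h.side_out hij hj hk h1).1 (h.side_out hij hj hl h2).1
    (h.side_out hij hj hk h1).2 (h.side_out hij hj hl h2).2

lemma compat_in (h : Enum Q n v) {i j k l : ℕ} (hij : i < j) (hj : j < n)
    (h1 : i ≤ k ∧ k ≤ j) (h2 : i ≤ l ∧ l ≤ j) :
    Compat s(v i, v j) s(v k, v l) := by
  rw [Sym2.eq_swap]
  exact compat_of_side (h.side_in hij hj h1.1 h1.2).1 (h.side_in hij hj h2.1 h2.2).1
    (h.side_in hij hj h1.1 h1.2).2 (h.side_in hij hj h2.1 h2.2).2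

lemma not_compat (h : Enum Q n v) {i j k l : ℕ} (hij : i < j) (hjk : j < k) (hkl : k < l)
    (hl : l < n) : ¬ Compat s(v i, v k) s(v j, v l) :=
  not_compat_cross (h.pos i j k hij hjk (by omega)) (h.pos i j l hij (by omega) hl)
    (h.pos i k l (by omega) hkl hl) (h.pos j k l hjk hkl hl)

/-- If all of `J` lies on one side of the chord `i j`, its points miss the interior. -/
lemma not_interior_of_sided (h : Enum Q n v) {J : Finset ℕ} (hJ : ∀ k ∈ J, k < n) {i j : ℕ}
    (hij : i < j) (hj : j < n) (hs : Sided J i j) {y : Pt} (hy : y ∈ segment ℝ (v i) (v j)) :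
    y ∉ interior (convexHull ℝ ((J.image v : Finset Pt) : Set Pt)) := by
  intro hi
  have h0 := crs_of_mem_segment hy
  rcases hs with hs | hs
  · have := interior_halfplane (u := v j) (w := v i) (h.ne hij hj).symm (fun q hq => by
      obtain ⟨k, hk, rfl⟩ := Finset.mem_image.1 (Finset.mem_coe.1 hq)
      exact (h.side_in hij hj (hs k hk).1 (hs k hk).2).1) hi
    rw [crs_swap] at this
    linarith
  · have := interior_halfplane (u := v i) (w := v j) (h.ne hij hj) (fun q hq => by
      obtain ⟨k, hk, rfl⟩ := Finset.mem_image.1 (Finset.mem_coe.1 hq)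
      exact (h.side_out hij hj (hJ k hk) (hs k hk)).1) hi
    linarith

lemma image_range (h : Enum Q n v) : (Finset.range n).image v = Q := by
  ext p
  rw [Finset.mem_image]
  constructor
  · rintro ⟨i, hi, rfl⟩; exact h.mem i (Finset.mem_range.1 hi)
  · intro hp
    obtain ⟨i, hi, rfl⟩ := h.surj p hp
    exact ⟨i, Finset.mem_range.2 hi, rfl⟩

lemma prp_of_diag (h : Enum Q n v) {i j : ℕ} (hij : i < j) (hj : j < n)
    (hd : IsDiagonalOf Q s(v i, v j)) : Prp (Finset.range n) i j := by
  have hm : ∃ y ∈ segment ℝ (v i) (v j), y ∈ interior (convexHull ℝ (Q : Set Pt)) := by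
    obtain ⟨p, -, q, -, he, hsub⟩ := hd
    have hy : (1/2 : ℝ) • p + (1/2 : ℝ) • q ∈ openSegment ℝ p q :=
      ⟨1/2, 1/2, by norm_num, by norm_num, by norm_num, rfl⟩
    refine ⟨_, ?_, hsub hy⟩
    have := openSegment_subset_segment ℝ p q hy
    rw [← seg2_mk, ← he] at this
    exact this
  obtain ⟨y, hy1, hy2⟩ := hm
  rw [← h.image_range] at hy2
  by_contra hp
  refine h.not_interior_of_sided (J := Finset.range n) (fun k hk => Finset.mem_range.1 hk) hij hj
    ?_ hy1 hy2
  by_contra hsd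
  simp only [Sided, not_or, not_forall] at hsd
  obtain ⟨⟨k, hk, hk'⟩, l, hl, hl'⟩ := hsd
  exact hp ⟨Finset.mem_range.2 (by omega), Finset.mem_range.2 hj, hij, ⟨l, hl, by omega⟩, k, hk,
    by omega⟩

def toList (v : ℕ → Pt) (J : Finset ℕ) : List Pt := (J.sort (· ≤ ·)).map v

lemma mem_toList {v : ℕ → Pt} {J : Finset ℕ} {p : Pt} : p ∈ toList v J ↔ ∃ k ∈ J, v k = p := by
  simp [toList]

lemma length_toList {v : ℕ → Pt} {J : Finset ℕ} : (toList v J).length = J.card := by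
  simp [toList]

lemma ccw_toList (h : Enum Q n v) {J : Finset ℕ} (hJ : ∀ k ∈ J, k < n) : CCW (toList v J) := by
  unfold CCW toList
  rw [List.triplewise_map, List.triplewise_iff_getElem]
  intro i j k hij hjk hk
  have hs := List.pairwise_iff_getElem.1 (Finset.sortedLT_sort J).pairwise
  exact h.pos _ _ _ (hs i j (by omega) (by omega) hij) (hs j k (by omega) (by omega) hjk)
    (hJ _ ((Finset.mem_sort _).1 (List.getElem_mem _)))

lemma sepd_toList (h : Enum Q n v) {J : Finset ℕ} (hJ : ∀ k ∈ J, k < n) {p q : Pt}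
    (hs : Sepd (toList v J) p q) : ∃ i j, Prp J i j ∧ s(p, q) = s(v i, v j) := by
  obtain ⟨hp, hq, ⟨r, hr, hr'⟩, t, ht, ht'⟩ := hs
  obtain ⟨i, hi, rfl⟩ := mem_toList.1 hp
  obtain ⟨j, hj, rfl⟩ := mem_toList.1 hq
  obtain ⟨k, hk, rfl⟩ := mem_toList.1 hr
  obtain ⟨l, hl, rfl⟩ := mem_toList.1 ht
  have key : ∀ i j k l, i ∈ J → j ∈ J → k ∈ J → l ∈ J → i < j → 0 < crs (v i) (v j) (v k) →
      crs (v i) (v j) (v l) < 0 → Prp J i j := by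
    intro i j k l hi hj hk hl hij h1 h2
    refine ⟨hi, hj, hij, ⟨l, hl, ?_⟩, k, hk, ?_⟩
    · by_contra hc
      have := (h.side_out hij (hJ j hj) (hJ l hl) (by omega)).1
      linarith
    · by_contra hc
      have := (h.side_in hij (hJ j hj) (k := k) (by omega) (by omega)).1
      rw [crs_swap] at this
      linarith
  rcases lt_trichotomy i j with hij | rfl | hij
  · exact ⟨i, j, key i j k l hi hj hk hl hij hr' ht', rfl⟩
  · rw [crs_same] at hr'; exact absurd hr' (lt_irrefl _)
  · refine ⟨j, i, key j i l k hj hi hl hk hij ?_ ?_, Sym2.eq_swap⟩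
    · rw [crs_swap]; linarith
    · rw [crs_swap]; linarith

end Enum


/-! ### The counting bound for ps-flippable sets with adjacent diagonals -/

lemma midpoint_open (p q : Pt) : (1/2 : ℝ) • p + (1/2 : ℝ) • q ∈ openSegment ℝ p q :=
  ⟨1/2, 1/2, by norm_num, by norm_num, by norm_num, rfl⟩

lemma cross_interior {K : Set Pt} {a b c d y : Pt} (ha : a ∈ K) (hb : b ∈ K) (hc : c ∈ K)
    (hd : d ∈ K) (h : crs a b c ≠ 0) (h1 : y ∈ openSegment ℝ a b) (h2 : y ∈ openSegment ℝ c d) :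
    y ∈ interior (convexHull ℝ K) := by
  have hw := tri_interior_of_open h h1 (midpoint_open c y)
  have hsub : convexHull ℝ ({a, b, c} : Set Pt) ⊆ convexHull ℝ K := by
    apply convexHull_mono
    intro p hp
    simp only [Set.mem_insert_iff, Set.mem_singleton_iff] at hp
    rcases hp with rfl | rfl | rfl <;> assumption
  have hw' := interior_mono hsub hw
  refine (convex_convexHull ℝ K).openSegment_interior_self_subset_interior hw'
    (subset_convexHull ℝ K hd) ?_
  obtain ⟨α, β, hα, hβ, hs, rfl⟩ := h2
  have h1α : (1 + α) ≠ 0 := by positivity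
  refine ⟨2 * α / (1 + α), β / (1 + α), by positivity, by positivity, ?_, ?_⟩
  · field_simp; linarith
  · have hb : β = 1 - α := by linarith
    subst hb
    ext
    · simp only [Prod.fst_add, Prod.smul_fst, smul_eq_mul]; field_simp; ring
    · simp only [Prod.snd_add, Prod.smul_snd, smul_eq_mul]; field_simp; ring

structure SubPoly {P : SimplePolygon} (D : PolyTriangulation P) (Q : Finset Pt) : Prop where
  vtx : ∀ p ∈ Q, P.IsVtx p
  three : 3 ≤ Q.card
  conv : InConvexPosition Q
  hull : ∀ p q, IsHullEdgeOf Q p q → D.IsEdgeOrDiag s(p, q)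
  emp : ∀ i, P.vtx i ∉ interior (convexHull ℝ (Q : Set Pt))

lemma IsDiagonalOf.mk' {Q : Finset Pt} {p q : Pt} (h : IsDiagonalOf Q s(p, q)) :
    p ∈ Q ∧ q ∈ Q ∧ openSegment ℝ p q ⊆ interior (convexHull ℝ (Q : Set Pt)) := by
  obtain ⟨a, ha, b, hb, he, h⟩ := h
  rw [Sym2.eq_iff] at he
  rcases he with ⟨rfl, rfl⟩ | ⟨rfl, rfl⟩
  · exact ⟨ha, hb, h⟩
  · exact ⟨hb, ha, by rwa [openSegment_symm]⟩

section perQ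
variable {P : SimplePolygon} {D : PolyTriangulation P} {Q : Finset Pt} {n : ℕ} {v : ℕ → Pt}
  {F : Finset (Sym2 Pt)}

def DrQ (D : PolyTriangulation P) (n : ℕ) (v : ℕ → Pt) (i j : ℕ) : Prop :=
  i < n ∧ j < n ∧ D.IsEdgeOrDiag s(v i, v j)

def FrQ (Q : Finset Pt) (n : ℕ) (v : ℕ → Pt) (F : Finset (Sym2 Pt)) (i j : ℕ) : Prop :=
  i < n ∧ j < n ∧ s(v i, v j) ∈ F ∧ IsDiagonalOf Q s(v i, v j)

lemma sysQ (he : Enum Q n v) (hF : F ⊆ D.diags) : Sys (DrQ D n v) (FrQ Q n v F) where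
  ds := fun i j h => ⟨h.2.1, h.1, by rw [Sym2.eq_swap]; exact h.2.2⟩
  fs := fun i j h => ⟨h.2.1, h.1, by rw [Sym2.eq_swap]; exact h.2.2⟩
  fd := fun i j h => ⟨h.1, h.2.1, Or.inr (hF h.2.2.1)⟩
  ni := fun i j k l hij hjk hkl h1 h2 =>
    he.not_compat hij hjk hkl h2.2.1 (D.compat h1.2.2 h2.2.2)

lemma frQ_uprp (he : Enum Q n v) (hF : F ⊆ D.diags) {i j : ℕ} (h : FrQ Q n v F i j) :
    UPrp (Finset.range n) i j := by
  have hne : i ≠ j := by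
    rintro rfl
    exact PolyTriangulation.IsEdgeOrDiag.ne (D := D) (Or.inr (hF h.2.2.1)) rfl
  rcases lt_or_gt_of_ne hne with hlt | hlt
  · exact Or.inl (he.prp_of_diag hlt h.2.1 h.2.2.2)
  · exact Or.inr (he.prp_of_diag hlt h.1 (by rw [Sym2.eq_swap]; exact h.2.2.2))

/-- non-`F` edges avoid the interior of the pieces -/
lemma avoid (hQ : SubPoly D Q) (he : Enum Q n v) {J : Finset ℕ} (hJ : J ⊆ Finset.range n)
    (hsd : ∀ i ∈ Finset.range n, ∀ j ∈ Finset.range n, i < j → DrQ D n v i j →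
      ¬ FrQ Q n v F i j → Sided J i j)
    {p q y : Pt} (hpq : D.IsEdgeOrDiag s(p, q)) (hn : s(p, q) ∉ F) (hy : y ∈ segment ℝ p q) :
    y ∉ interior (convexHull ℝ ((J.image v : Finset Pt) : Set Pt)) := by
  intro hi
  have hJ' : ∀ k ∈ J, k < n := fun k hk => Finset.mem_range.1 (hJ hk)
  have hsub : interior (convexHull ℝ ((J.image v : Finset Pt) : Set Pt)) ⊆
      interior (convexHull ℝ (Q : Set Pt)) := by
    apply interior_mono
    apply convexHull_mono
    intro r hr
    obtain ⟨k, hk, rfl⟩ := Finset.mem_image.1 (Finset.mem_coe.1 hr)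
    exact he.mem k (hJ' k hk)
  obtain ⟨hp, hq⟩ := trap P hQ.vtx hQ.emp hpq.vtx.1 hpq.vtx.2
    (fun r t hrt => D.compat (hQ.hull r t hrt) hpq) hy (hsub hi)
  obtain ⟨i, hin, rfl⟩ := he.surj p hp
  obtain ⟨j, hjn, rfl⟩ := he.surj q hq
  have hne : i ≠ j := by rintro rfl; exact hpq.ne rfl
  rcases lt_or_gt_of_ne hne with hlt | hlt
  · exact he.not_interior_of_sided hJ' hlt hjn (hsd i (Finset.mem_range.2 hin) j
      (Finset.mem_range.2 hjn) hlt ⟨hin, hjn, hpq⟩ fun h => hn h.2.2.1) hy hi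
  · refine he.not_interior_of_sided hJ' hlt hin (hsd j (Finset.mem_range.2 hjn) i
      (Finset.mem_range.2 hin) hlt ⟨hjn, hin, by rwa [Sym2.eq_swap]⟩ fun h => hn ?_)
      (by rwa [segment_symm]) hi
    rw [Sym2.eq_swap]; exact h.2.2.1

lemma piece_facts (hQ : SubPoly D Q) (he : Enum Q n v) (hF : F ⊆ D.diags) {J : Finset ℕ}
    (hJ : J ⊆ Finset.range n) (hne : (FS (FrQ Q n v F) J).Nonempty)
    (hsd : ∀ i ∈ Finset.range n, ∀ j ∈ Finset.range n, i < j → DrQ D n v i j →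
      ¬ FrQ Q n v F i j → Sided J i j) {i j : ℕ} (hij : Prp J i j) :
    P.IsDiagonal s(v i, v j) ∧ (∀ e ∈ D.diags \ F, Compat s(v i, v j) e) ∧
      openSegment ℝ (v i) (v j) ⊆ interior (convexHull ℝ (Q : Set Pt)) := by
  have hJ' : ∀ k ∈ J, k < n := fun k hk => Finset.mem_range.1 (hJ hk)
  have hsub : interior (convexHull ℝ ((J.image v : Finset Pt) : Set Pt)) ⊆
      interior (convexHull ℝ (Q : Set Pt)) := by
    apply interior_mono
    apply convexHull_mono
    intro r hr
    obtain ⟨k, hk, rfl⟩ := Finset.mem_image.1 (Finset.mem_coe.1 hr)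
    exact he.mem k (hJ' k hk)
  have hvt : ∀ k ∈ J, P.IsVtx (v k) := fun k hk => hQ.vtx _ (he.mem k (hJ' k hk))
  have hni : ∀ k ∈ J, v k ∉ interior (convexHull ℝ ((J.image v : Finset Pt) : Set Pt)) := by
    intro k hk h
    obtain ⟨m, hm⟩ := hvt k hk
    exact hQ.emp m (hm ▸ hsub h)
  have hopen : ∀ i j, Prp J i j → openSegment ℝ (v i) (v j) ⊆
      interior (convexHull ℝ ((J.image v : Finset Pt) : Set Pt)) := by
    rintro i j ⟨hi, hj, hlt, ⟨k, hk, hk1, hk2⟩, l, hl, hl1⟩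
    have hm : ∀ k ∈ J, v k ∈ J.image v := fun k hk => Finset.mem_image_of_mem v hk
    refine (hull_or_diag (hm i hi) (hm j hj) (he.ne hlt (hJ' j hj)) (hni i hi)
      (hni j hj)).resolve_left ?_
    rintro ⟨-, -, -, hfr⟩
    have hncomp : ¬ Compat s(v i, v j) s(v k, v l) := by
      rcases hl1 with h | h
      · rw [Sym2.eq_swap (a := v k)]
        intro hc
        exact he.not_compat h hk1 hk2 (hJ' j hj) hc.symm
      · exact he.not_compat hk1 hk2 h (hJ' l hl)
    obtain ⟨y, hy1, hy2⟩ := P.cross_of_not_compat (hvt i hi) (hvt j hj) (hvt k hk) (hvt l hl) hncomp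
    have := cross_interior (K := ((J.image v : Finset Pt) : Set Pt)) (hm i hi) (hm j hj) (hm k hk)
      (hm l hl) (he.btw hk1 hk2 (hJ' j hj)).ne hy1 hy2
    exact (hfr (openSegment_subset_segment _ _ _ hy1)).2 this
  have hin : interior (convexHull ℝ ((J.image v : Finset Pt) : Set Pt)) ⊆ P.inside := by
    obtain ⟨⟨a, b⟩, hab⟩ := hne
    obtain ⟨hab, hfr⟩ := mem_FS.1 hab
    have hmid := midpoint_open (v a) (v b)
    refine inside_of_connected (convex_convexHull ℝ _).interior.isPreconnected ?_
      (hopen a b hab hmid) ((D.isDiag _ (hF hfr.2.2.1)).mk'.2.2 hmid)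
    intro y hy hyb
    obtain ⟨m, hm⟩ := Set.mem_iUnion.1 hyb
    refine avoid (F := F) hQ he hJ hsd (p := P.vtx m) (q := P.vtx (finRotate P.n m))
      (Or.inl ⟨m, rfl⟩) ?_ hm hy
    intro hmem
    have h1 := (D.isDiag _ (hF hmem)).mk'.2.2 (midpoint_open _ _)
    exact h1.1 (Set.mem_iUnion.2 ⟨m, openSegment_subset_segment _ _ _ (midpoint_open _ _)⟩)
  refine ⟨P.isDiagonal_of (hvt i hij.1) (hvt j hij.2.1) ((hopen i j hij).trans hin), ?_,
    (hopen i j hij).trans hsub⟩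
  intro e hee
  obtain ⟨he1, he2⟩ := Finset.mem_sdiff.1 hee
  induction e with | h p q => ?_
  by_contra hc
  have hD : D.IsEdgeOrDiag s(p, q) := Or.inr he1
  obtain ⟨y, hy1, hy2⟩ := P.cross_of_not_compat (hvt i hij.1) (hvt j hij.2.1) hD.vtx.1 hD.vtx.2 hc
  exact avoid (F := F) hQ he hJ hsd hD he2 (openSegment_subset_segment _ _ _ hy2)
    (hopen i j hij hy1)

def TQ (F G : Finset (Sym2 Pt)) (Q : Finset Pt) : Finset (Sym2 Pt) :=
  G.filter fun g => ∃ a b c, g = s(a, b) ∧ s(a, c) ∈ F ∧ s(b, c) ∈ F ∧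
    IsDiagonalOf Q s(a, c) ∧ IsDiagonalOf Q s(b, c)

lemma perQ {x : ℝ} (hx : 1 ≤ x) (hQ : SubPoly D Q) (hF : F ⊆ D.diags) {G : Finset (Sym2 Pt)}
    (hG : G ⊆ D.diags) (hFG : Disjoint F G) :
    ∃ Ls : List (List Pt),
      2 ^ (F.filter (IsDiagonalOf Q)).card * x ^ (TQ F G Q).card ≤
        (Ls.map fun L => HH x L.length).prod ∧
      (∀ L ∈ Ls, CCW L ∧ ∀ p q, Sepd L p q → P.IsDiagonal s(p, q) ∧
        (∀ e ∈ D.diags \ F, Compat s(p, q) e) ∧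
        openSegment ℝ p q ⊆ interior (convexHull ℝ (Q : Set Pt))) ∧
      Ls.Pairwise fun L L' => ∀ p q r t, Sepd L p q → Sepd L' r t →
        Compat s(p, q) s(r, t) := by
  obtain ⟨n, v, he⟩ := exists_enum P hQ.vtx hQ.three hQ.conv
  have hs := sysQ (D := D) he hF
  obtain ⟨Js, hJ1, hJ2, hJ3⟩ := lemPoly hx hs _ (Finset.range n) le_rfl
  refine ⟨Js.map (Enum.toList v), ?_, ?_, ?_⟩
  · have hc1 : (F.filter (IsDiagonalOf Q)).card ≤ (FS (FrQ Q n v F) (Finset.range n)).card := by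
      refine Finset.card_le_card_of_surjOn (fun e => s(v e.1, v e.2)) ?_
      intro e hee
      obtain ⟨h1, h2⟩ := Finset.mem_filter.1 (Finset.mem_coe.1 hee)
      induction e with | h p q => ?_
      obtain ⟨i, hi, rfl⟩ := he.surj p h2.mk'.1
      obtain ⟨j, hj, rfl⟩ := he.surj q h2.mk'.2.1
      have hfr : FrQ Q n v F i j := ⟨hi, hj, h1, h2⟩
      rcases frQ_uprp (D := D) he hF hfr with h | h
      · exact ⟨(i, j), Finset.mem_coe.2 (mem_FS.2 ⟨h, hfr⟩), rfl⟩
      · exact ⟨(j, i), Finset.mem_coe.2 (mem_FS.2 ⟨h, hs.fs _ _ hfr⟩), Sym2.eq_swap⟩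
    have hc2 : (TQ F G Q).card ≤ (TS (DrQ D n v) (FrQ Q n v F) (Finset.range n)).card := by
      refine Finset.card_le_card_of_surjOn (fun e => s(v e.1, v e.2)) ?_
      intro e hee
      obtain ⟨h1, a, b, c, rfl, h3, h4, h5, h6⟩ := Finset.mem_filter.1 (Finset.mem_coe.1 hee)
      obtain ⟨i, hi, rfl⟩ := he.surj a h5.mk'.1
      obtain ⟨j, hj, rfl⟩ := he.surj b h6.mk'.1
      obtain ⟨k, hk, rfl⟩ := he.surj c h6.mk'.2.1
      have f1 : FrQ Q n v F i k := ⟨hi, hk, h3, h5⟩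
      have f2 : FrQ Q n v F j k := ⟨hj, hk, h4, h6⟩
      have u1 := frQ_uprp (D := D) he hF f1
      have u2 := frQ_uprp (D := D) he hF f2
      have hd : DrQ D n v i j := ⟨hi, hj, Or.inr (hG h1)⟩
      have hn : ¬ FrQ Q n v F i j := fun h => Finset.disjoint_left.1 hFG h.2.2.1 h1
      have hne : i ≠ j := by rintro rfl; exact hd.2.2.ne rfl
      rcases lt_or_gt_of_ne hne with hlt | hlt
      · exact ⟨(i, j), Finset.mem_coe.2 (mem_TS.2 ⟨hlt, hd, hn, k, u1, f1, u2, f2⟩), rfl⟩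
      · exact ⟨(j, i), Finset.mem_coe.2 (mem_TS.2 ⟨hlt, hs.ds _ _ hd, fun h => hn (hs.fs _ _ h),
          k, u2, f2, u1, f1⟩), Sym2.eq_swap⟩
    rw [List.map_map]
    have : ((fun L : List Pt => HH x L.length) ∘ Enum.toList v) = fun J => HH x J.card := by
      funext J; simp [Enum.length_toList]
    rw [this]
    refine le_trans ?_ hJ3
    gcongr
    · norm_num
  · intro L hL
    obtain ⟨J, hJ, rfl⟩ := List.mem_map.1 hL
    obtain ⟨g1, g2, g3⟩ := hJ1 J hJ
    have hJ' : ∀ k ∈ J, k < n := fun k hk => Finset.mem_range.1 (g1 hk)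
    refine ⟨he.ccw_toList hJ', fun p q hpq => ?_⟩
    obtain ⟨i, j, hij, heq⟩ := he.sepd_toList hJ' hpq
    have := piece_facts hQ he hF g1 g2 g3 hij
    rw [heq]
    refine ⟨this.1, this.2.1, ?_⟩
    rw [Sym2.eq_iff] at heq
    rcases heq with ⟨rfl, rfl⟩ | ⟨rfl, rfl⟩
    · exact this.2.2
    · rw [openSegment_symm]; exact this.2.2
  · rw [List.pairwise_map]
    refine hJ2.imp_of_mem ?_
    rintro J J' hJ hJ' ⟨p, q, hlt, h1, h2⟩ a b c d hs1 hs2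
    have k1 : ∀ k ∈ J, k < n := fun k hk => Finset.mem_range.1 ((hJ1 J hJ).1 hk)
    have k2 : ∀ k ∈ J', k < n := fun k hk => Finset.mem_range.1 ((hJ1 J' hJ').1 hk)
    obtain ⟨i, j, hij, heq⟩ := he.sepd_toList k1 hs1
    obtain ⟨k, l, hkl, heq'⟩ := he.sepd_toList k2 hs2
    rw [heq, heq']
    have := h1 i hij.1
    have := h1 j hij.2.1
    have := h2 k hkl.1
    have := h2 l hkl.2.1
    exact he.compat_out hij.2.2.1 (k1 j hij.2.1) (k2 k hkl.1) (k2 l hkl.2.1) (by omega) (by omega)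

/-- A face adjacent to a diagonal of `Q` lies inside `Q`. -/
lemma face_in (hQ : SubPoly D Q) {a b c : Pt} (hf : D.IsFace a b c)
    (hd : IsDiagonalOf Q s(a, c)) :
    interior (convexHull ℝ ({a, b, c} : Set Pt)) ⊆ interior (convexHull ℝ (Q : Set Pt)) := by
  intro w hw
  by_contra hwn
  have hcv := convex_convexHull ℝ ({a, b, c} : Set Pt)
  have hz := hd.mk'.2.2 (midpoint_open a c)
  have hzc : (1/2 : ℝ) • a + (1/2 : ℝ) • c ∈
      closure (interior (convexHull ℝ ({a, b, c} : Set Pt))) := by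
    rw [hcv.closure_interior_eq_closure_of_nonempty_interior ⟨w, hw⟩]
    apply subset_closure
    exact segment_subset_convexHull (by simp) (by simp)
      (openSegment_subset_segment _ _ _ (midpoint_open a c))
  obtain ⟨y, hy1, hy2⟩ := mem_closure_iff.1 hzc _ isOpen_interior hz
  obtain ⟨u, hu1, hu2⟩ := exists_frontier (hull_closed Q) hy1 hwn
  have hu3 : u ∈ interior (convexHull ℝ ({a, b, c} : Set Pt)) :=
    hcv.interior.segment_subset hy2 hw hu1
  rcases frontier_hull P hQ.vtx ⟨y, hy1⟩ hu2 with h | ⟨p, q, hpq, hup⟩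
  · obtain ⟨i, rfl⟩ := hQ.vtx u h
    exact hf.2.2.2.2.2.2 i hu3
  · exact face_empty hf (hQ.hull p q hpq) hup hu3

end perQ

theorem base_lemma {x : ℝ} (hx : 1 + 4 * x ^ 2 - 4 * x ^ 3 = 0) {P : SimplePolygon}
    (D : PolyTriangulation P) {F G : Finset (Sym2 Pt)} (hF : F ⊆ D.diags) (hG : G ⊆ D.diags)
    (hFG : Disjoint F G) (Qs : Finset (Finset Pt)) (hQs : ∀ Q ∈ Qs, SubPoly D Q)
    (hdis : ∀ Q ∈ Qs, ∀ Q' ∈ Qs, Q ≠ Q' →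
      interior (convexHull ℝ (Q : Set Pt)) ∩ interior (convexHull ℝ (Q' : Set Pt)) = ∅)
    (hFQ : ∀ e ∈ F, ∃ Q ∈ Qs, IsDiagonalOf Q e)
    (hGF : ∀ g ∈ G, ∃ a b c, g = s(a, b) ∧ D.IsFace a b c ∧ s(a, c) ∈ F ∧ s(b, c) ∈ F) :
    2 ^ F.card * x ^ G.card ≤ (cnt P (D.diags \ F) : ℝ) := by
  have hx1 : 1 ≤ x := (root_facts hx).1.le
  have hper : ∀ Q, ∃ Ls : List (List Pt), Q ∈ Qs →
      2 ^ (F.filter (IsDiagonalOf Q)).card * x ^ (TQ F G Q).card ≤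
        (Ls.map fun L => HH x L.length).prod ∧
      (∀ L ∈ Ls, CCW L ∧ ∀ p q, Sepd L p q → P.IsDiagonal s(p, q) ∧
        (∀ e ∈ D.diags \ F, Compat s(p, q) e) ∧
        openSegment ℝ p q ⊆ interior (convexHull ℝ (Q : Set Pt))) ∧
      Ls.Pairwise fun L L' => ∀ p q r t, Sepd L p q → Sepd L' r t →
        Compat s(p, q) s(r, t) := by
    intro Q
    by_cases h : Q ∈ Qs
    · obtain ⟨Ls, h1⟩ := perQ hx1 (hQs Q h) hF hG hFG
      exact ⟨Ls, fun _ => h1⟩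
    · exact ⟨[], fun h' => absurd h' h⟩
  choose Lf hLf using hper
  have hgood : Good P (D.diags \ F) (Qs.toList.flatMap Lf) := by
    refine ⟨fun e he => D.isDiag e (Finset.mem_sdiff.1 he).1, ?_, ?_, ?_, ?_⟩
    · intro e he f hf
      exact D.compat (Or.inr (Finset.mem_sdiff.1 he).1) (Or.inr (Finset.mem_sdiff.1 hf).1)
    · intro L hL
      obtain ⟨Q, hQ, hL⟩ := List.mem_flatMap.1 hL
      exact ((hLf Q (Finset.mem_toList.1 hQ)).2.1 L hL).1
    · intro L hL p q hpq
      obtain ⟨Q, hQ, hL⟩ := List.mem_flatMap.1 hL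
      have := ((hLf Q (Finset.mem_toList.1 hQ)).2.1 L hL).2 p q hpq
      exact ⟨this.1, this.2.1⟩
    · rw [List.pairwise_flatMap]
      refine ⟨fun Q hQ => (hLf Q (Finset.mem_toList.1 hQ)).2.2, ?_⟩
      refine (Finset.nodup_toList Qs).imp_of_mem ?_
      intro Q Q' hQ hQ' hne L hL L' hL' p q r t hs hs'
      rw [Finset.mem_toList] at hQ hQ'
      obtain ⟨a1, -, a2⟩ := ((hLf Q hQ).2.1 L hL).2 p q hs
      obtain ⟨b1, -, b2⟩ := ((hLf Q' hQ').2.1 L' hL').2 r t hs'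
      by_contra hc
      obtain ⟨y, hy1, hy2⟩ := P.cross_of_not_compat a1.mk'.1 a1.mk'.2.1 b1.mk'.1 b1.mk'.2.1 hc
      have : y ∈ interior (convexHull ℝ (Q : Set Pt)) ∩ interior (convexHull ℝ (Q' : Set Pt)) :=
        ⟨a2 hy1, b2 hy2⟩
      rw [hdis Q hQ Q' hQ' hne] at this
      exact this
  have hcount := good_count hx P _ _ _ le_rfl hgood
  refine le_trans ?_ hcount
  have hprod : ((Qs.toList.flatMap Lf).map fun L => HH x L.length).prod =
      ∏ Q ∈ Qs, ((Lf Q).map fun L => HH x L.length).prod := by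
    rw [← Finset.prod_map_toList]
    generalize Qs.toList = l
    induction l with
    | nil => simp
    | cons a l ih => simp [ih]
  rw [hprod]
  have hFc : F.card ≤ ∑ Q ∈ Qs, (F.filter (IsDiagonalOf Q)).card := by
    refine (Finset.card_le_card ?_).trans Finset.card_biUnion_le
    intro e he
    obtain ⟨Q, hQ, h⟩ := hFQ e he
    exact Finset.mem_biUnion.2 ⟨Q, hQ, Finset.mem_filter.2 ⟨he, h⟩⟩
  have hGc : G.card ≤ ∑ Q ∈ Qs, (TQ F G Q).card := by
    refine (Finset.card_le_card ?_).trans Finset.card_biUnion_le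
    intro g hg
    obtain ⟨a, b, c, rfl, hf, h1, h2⟩ := hGF g hg
    obtain ⟨Q, hQ, hd⟩ := hFQ _ h1
    obtain ⟨Q', hQ', hd'⟩ := hFQ _ h2
    have i1 := face_in (hQs Q hQ) hf hd
    have hf' : D.IsFace b a c := by
      obtain ⟨f1, f2, f3, f4, f5, f6, f7⟩ := hf
      exact ⟨f2, f1, f3, by rwa [Sym2.eq_swap], f6, f5, by rwa [Set.insert_comm]⟩
    have i2 := face_in (hQs Q' hQ') hf' hd'
    rw [Set.insert_comm] at i2
    have hw := tri_interior_of_open (face_crs hf) (midpoint_open a b) (midpoint_open c _)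
    have : Q = Q' := by
      by_contra hne
      have h3 : _ ∈ interior (convexHull ℝ (Q : Set Pt)) ∩
        interior (convexHull ℝ (Q' : Set Pt)) := ⟨i1 hw, i2 hw⟩
      rw [hdis Q hQ Q' hQ' hne] at h3
      exact h3
    subst this
    exact Finset.mem_biUnion.2 ⟨Q, hQ, Finset.mem_filter.2 ⟨hg, a, b, c, rfl, h1, h2, hd, hd'⟩⟩
  calc 2 ^ F.card * x ^ G.card
      ≤ 2 ^ (∑ Q ∈ Qs, (F.filter (IsDiagonalOf Q)).card) * x ^ (∑ Q ∈ Qs, (TQ F G Q).card) := by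
        gcongr
        · norm_num
    _ = ∏ Q ∈ Qs, (2 ^ (F.filter (IsDiagonalOf Q)).card * x ^ (TQ F G Q).card) := by
        rw [Finset.prod_mul_distrib, Finset.prod_pow_eq_pow_sum, Finset.prod_pow_eq_pow_sum]
    _ ≤ _ := Finset.prod_le_prod (fun Q _ => by positivity) fun Q hQ => (hLf Q hQ).1


/-! ### The main induction -/

lemma weight_le {x : ℝ} (h1 : 1 < x) (h2 : x < 6 / 5) {i j : ℕ} (hj : j ≤ 2) (hij : i + j ≤ 4) :
    2 ^ j * x ^ i ≤ 4 * x ^ 2 := by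
  have hx0 : 0 < x := by linarith
  have hs : 1 < x ^ 2 := by nlinarith
  have hs2 : x ^ 2 ≤ 2 := by nlinarith
  have hi : x ^ i ≤ x ^ (4 - j) := pow_le_pow_right₀ h1.le (by omega)
  refine (mul_le_mul_of_nonneg_left hi (by positivity)).trans ?_
  interval_cases j
  · norm_num; nlinarith
  · norm_num; nlinarith
  · norm_num

lemma weight_step {x : ℝ} (hx : 1 + 4 * x ^ 2 - 4 * x ^ 3 = 0) {f m i j : ℕ} (hj : j ≤ 2)
    (hij : i + j ≤ 4) :
    2 ^ (f + j) * x ^ (m + i + 1) ≤ 2 ^ (f + j) * x ^ (m + i) + 2 ^ f * x ^ m := by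
  obtain ⟨h1, h2⟩ := root_facts hx
  have hx0 : 0 < x := by linarith
  have hw := weight_le h1 h2 hj hij
  have h3 : 2 ^ j * x ^ i * (x - 1) ≤ 1 := by
    have := mul_le_mul_of_nonneg_right hw (sub_nonneg.2 h1.le)
    nlinarith
  have h4 : 0 < 2 ^ f * x ^ m := by positivity
  have := mul_le_mul_of_nonneg_left h3 h4.le
  have e : 2 ^ (f + j) * x ^ (m + i + 1) - 2 ^ (f + j) * x ^ (m + i) =
      2 ^ f * x ^ m * (2 ^ j * x ^ i * (x - 1)) := by ring
  linarith

lemma nbrs_pair {a b c d : Pt} {F : Finset (Sym2 Pt)} (h : 2 < (nbrs a b c d ∩ F).card) :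
    (s(a, c) ∈ F ∧ s(b, c) ∈ F) ∨ (s(a, d) ∈ F ∧ s(b, d) ∈ F) := by
  by_contra hc
  push Not at hc
  obtain ⟨hc1, hc2⟩ := hc
  have hsub : ∃ u v, nbrs a b c d ∩ F ⊆ {u, v} := by
    by_cases h1 : s(a, c) ∈ F <;> by_cases h2 : s(a, d) ∈ F
    · refine ⟨s(a, c), s(a, d), ?_⟩
      have := hc1 h1; have := hc2 h2
      intro e he; simp only [nbrs, Finset.mem_inter, Finset.mem_insert, Finset.mem_singleton] at he ⊢
      grind
    · refine ⟨s(a, c), s(b, d), ?_⟩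
      have := hc1 h1
      intro e he; simp only [nbrs, Finset.mem_inter, Finset.mem_insert, Finset.mem_singleton] at he ⊢
      grind
    · refine ⟨s(b, c), s(a, d), ?_⟩
      have := hc2 h2
      intro e he; simp only [nbrs, Finset.mem_inter, Finset.mem_insert, Finset.mem_singleton] at he ⊢
      grind
    · refine ⟨s(b, c), s(b, d), ?_⟩
      intro e he; simp only [nbrs, Finset.mem_inter, Finset.mem_insert, Finset.mem_singleton] at he ⊢
      grind
  obtain ⟨u, v, huv⟩ := hsub
  have := Finset.card_le_card huv
  have := Finset.card_le_two (a := u) (b := v)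
  omega

lemma main_induction {x : ℝ} (hx : 1 + 4 * x ^ 2 - 4 * x ^ 3 = 0) {P : SimplePolygon}
    (D : PolyTriangulation P) (Qs : Finset (Finset Pt)) (hQs : ∀ Q ∈ Qs, SubPoly D Q)
    (hdis : ∀ Q ∈ Qs, ∀ Q' ∈ Qs, Q ≠ Q' →
      interior (convexHull ℝ (Q : Set Pt)) ∩ interior (convexHull ℝ (Q' : Set Pt)) = ∅) :
    ∀ (n : ℕ) (F G : Finset (Sym2 Pt)), G.card = n → F ⊆ D.diags → G ⊆ D.diags →
      Disjoint F G → (∀ e ∈ F, ∃ Q ∈ Qs, IsDiagonalOf Q e) → (∀ g ∈ G, D.IsFlippable g) →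
      2 ^ F.card * x ^ G.card ≤ (cnt P (D.diags \ (F ∪ G)) : ℝ) := by
  intro n
  induction n using Nat.strong_induction_on with
  | _ n ih =>
  intro F G hn hF hG hFG hFQ hGfl
  by_cases hex : ∃ g ∈ G, ∃ a b c d, g = s(a, b) ∧ FlipData D a b c d ∧ (nbrs a b c d ∩ F).card ≤ 2
  · obtain ⟨g, hg, a, b, c, d, rfl, hfl, hj⟩ := hex
    set N := nbrs a b c d with hN
    set G' := G.erase s(a, b) with hG'
    have hgF : s(a, b) ∉ F := fun h => Finset.disjoint_left.1 hFG h hg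
    have hG'G : G' ⊆ G := Finset.erase_subset _ _
    have hG'c : G'.card + 1 = G.card := Finset.card_erase_add_one hg
    have hflip := cnt_flip D (hG hg) hfl (S := D.diags \ (F ∪ G))
      (S' := D.diags \ ((F \ N) ∪ (G' \ N)))
      (by simp [hg]) (by
        refine Finset.sdiff_subset_sdiff le_rfl ?_
        exact Finset.union_subset_union Finset.sdiff_subset (Finset.sdiff_subset.trans hG'G))
      (by
        have := hG hg
        simp [hG', hgF, this])
      (by
        intro f hf hfD
        rw [← hN] at hf
        simp [hf, hfD])
    have e1 : insert s(a, b) (D.diags \ (F ∪ G)) = D.diags \ (F ∪ G') := by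
      ext e
      have := hG hg
      by_cases h : e = s(a, b)
      · subst h; simp [hG', hgF, this]
      · simp [hG', h]
    rw [e1] at hflip
    have i1 := ih G'.card (by omega) F G' rfl hF (hG'G.trans hG)
      (hFG.mono_right hG'G) hFQ (fun g h => hGfl g (hG'G h))
    have hlt : (G' \ N).card < n :=
      lt_of_le_of_lt (Finset.card_le_card Finset.sdiff_subset) (by omega)
    have i2 := ih (G' \ N).card hlt (F \ N) (G' \ N) rfl (Finset.sdiff_subset.trans hF)
      (Finset.sdiff_subset.trans (hG'G.trans hG))
      ((hFG.mono_right (Finset.sdiff_subset.trans hG'G)).mono_left Finset.sdiff_subset)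
      (fun e h => hFQ e (Finset.sdiff_subset h))
      (fun g h => hGfl g (hG'G (Finset.sdiff_subset h)))
    have cF : (F \ N).card + (N ∩ F).card = F.card := by
      rw [Finset.inter_comm]; exact Finset.card_sdiff_add_card_inter F N
    have cG : (G' \ N).card + (N ∩ G').card = G'.card := by
      rw [Finset.inter_comm]; exact Finset.card_sdiff_add_card_inter G' N
    have cN : (N ∩ G').card + (N ∩ F).card ≤ 4 := by
      rw [← Finset.card_union_of_disjoint]
      · exact (Finset.card_le_card (Finset.union_subset Finset.inter_subset_left
          Finset.inter_subset_left)).trans (by rw [hN]; exact Finset.card_le_four)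
      · exact ((hFG.mono_right hG'G).symm.mono_left Finset.inter_subset_right).mono_right
          Finset.inter_subset_right
    have hw := weight_step hx (f := (F \ N).card) (m := (G' \ N).card) hj cN
    rw [cF, cG, hG'c] at hw
    have hflip' : (cnt P (D.diags \ (F ∪ G')) : ℝ) + cnt P (D.diags \ ((F \ N) ∪ (G' \ N))) ≤
      cnt P (D.diags \ (F ∪ G)) := by exact_mod_cast hflip
    linarith
  · push Not at hex
    have hb := base_lemma hx D hF hG hFG Qs hQs hdis hFQ (by
      intro g hg
      obtain ⟨-, a, b, c, d, rfl, -, h1, h2, h3⟩ := hGfl g hg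
      rcases nbrs_pair (hex _ hg a b c d rfl ⟨h1, h2, h3⟩) with h | h
      · exact ⟨a, b, c, rfl, h1, h⟩
      · exact ⟨a, b, d, rfl, h2, h⟩)
    refine hb.trans ?_
    exact_mod_cast cnt_mono P (Finset.sdiff_subset_sdiff le_rfl Finset.subset_union_left)

/-- with `x` the unique real root of `1 + 4x² - 4x³`, every simple
polygon with a triangulation having `k` flippable diagonals, `l ≤ k` of which
form a ps-flippable set, has at least `2^l · x^{k-l}` triangulations. -/
theorem statement9 (x : ℝ) (hx : 1 + 4 * x ^ 2 - 4 * x ^ 3 = 0)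
    (P : SimplePolygon) (D : PolyTriangulation P) (F : Finset (Sym2 Pt))
    (hFps : D.IsPsFlippableSet F) (hFflip : ∀ e ∈ F, D.IsFlippable e) :
    (2 : ℝ) ^ F.card * x ^ (D.flipCount - F.card) ≤ (polyTriCount P : ℝ) := by
  obtain ⟨hF, Qs, hQs, hdis, hFQ⟩ := hFps
  have hsub : F ⊆ D.diags.filter (fun e => D.IsFlippable e) := fun e he =>
    Finset.mem_filter.2 ⟨hF he, hFflip e he⟩
  have hm := main_induction hx D Qs
    (fun Q hQ => ⟨(hQs Q hQ).1, (hQs Q hQ).2.1, (hQs Q hQ).2.2.1, (hQs Q hQ).2.2.2.1,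
      (hQs Q hQ).2.2.2.2⟩) hdis _ F (D.diags.filter (fun e => D.IsFlippable e) \ F) rfl hF
    (Finset.sdiff_subset.trans (Finset.filter_subset _ _)) Finset.disjoint_sdiff hFQ
    (fun g hg => (Finset.mem_filter.1 (Finset.sdiff_subset hg)).2)
  rw [Finset.card_sdiff_of_subset hsub] at hm
  refine hm.trans ?_
  exact_mod_cast cnt_le P _
end
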